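/- Let β > 0 with β² ≠ 1/4, set γ = √(1/4 − β²) (principal square root) and μ = Re γ. For each integer m ≥ 1 let ρ⁰_m, ω⁰_m : ℝ → ℂ be smooth and compactly supported, set W(ζ) = W_{0,γ}(2mζ), G_m(η,ξ,y) = (∂_y² − m²)(ρ⁰_m(ξ+y−η) − β^{−2} ξ ω⁰_m(ξ+y−η)), ρ_m(t,y) = (e^{−imyt} cos(γπ)/(2mπ)) [∫₀^∞ e^{imηt} (W(η)/η) ∫₀^∞ W(ξ) G_m(η,ξ,y) dξ dη + ∫₀^∞ e^{−imηt} (W(η)/η) ∫₀^∞ W(ξ) G_m(−η,−ξ,y) dξ dη], and Q_{1,m} = ∑_{k=0}^{3} (‖∂_y^k ρ⁰_m‖_{L²(ℝ)} + ‖∂_y^k ω⁰_m‖_{L²(ℝ)}). Then there exists a constant C > 0 depending only on β such that for all t ≥ 1, ( ∑_{m=1}^∞ ‖ρ_m(t,·)‖²_{L²(ℝ)} )^{1/2} ≤ C t^{−1/2+μ} ( ∑_{m=1}^∞ Q_{1,m}² )^{1/2}. -/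

import Mathlib

open MeasureTheory Complex Set
open scoped ENNReal Real

noncomputable section

/-- Pochhammer symbol `(a)_s = a (a+1) ⋯ (a+s−1)`. -/
def poch (a : ℂ) (s : ℕ) : ℂ := ∏ i ∈ Finset.range s, (a + (i : ℂ))

/-- Confluent hypergeometric function `M(a,b,ζ) = ∑_s (a)_s/((b)_s s!) ζ^s`. -/
def chgM (a b ζ : ℂ) : ℂ := ∑' s : ℕ, poch a s / (poch b s * (Nat.factorial s : ℂ)) * ζ ^ s

/-- Whittaker function `M_{0,γ}(ζ) = e^{−ζ/2} ζ^{1/2+γ} M(1/2+γ, 1+2γ, ζ)`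
(principal branch of the complex power). -/
def whittM (γ ζ : ℂ) : ℂ :=
  Complex.exp (-ζ / 2) * ζ ^ ((1 : ℂ) / 2 + γ) * chgM ((1 : ℂ) / 2 + γ) (1 + 2 * γ) ζ

/-- Whittaker function
`W_{0,γ}(ζ) = (Γ(−2γ)/Γ(1/2−γ)) M_{0,γ}(ζ) + (Γ(2γ)/Γ(1/2+γ)) M_{0,−γ}(ζ)`. -/
def whittW (γ ζ : ℂ) : ℂ :=
  Complex.Gamma (-(2 * γ)) / Complex.Gamma ((1 : ℂ) / 2 - γ) * whittM γ ζ
    + Complex.Gamma (2 * γ) / Complex.Gamma ((1 : ℂ) / 2 + γ) * whittM (-γ) ζ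

/-- `γ = √(1/4 − β²)`, principal square root. -/
def gam (β : ℝ) : ℂ := ((1 / 4 - β ^ 2 : ℝ) : ℂ) ^ ((1 : ℂ) / 2)

/-- `G_m(η,ξ,y) = (∂_y² − m²)(ρ⁰(ξ+y−η) − β^{−2} ξ ω⁰(ξ+y−η))`. -/
def Gm (β : ℝ) (m : ℕ) (ρ₀ ω₀ : ℝ → ℂ) (η ξ y : ℝ) : ℂ :=
  (deriv (deriv ρ₀) (ξ + y - η) - (m : ℂ) ^ 2 * ρ₀ (ξ + y - η))
    - (1 / (β : ℂ) ^ 2) * (ξ : ℂ) *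
        (deriv (deriv ω₀) (ξ + y - η) - (m : ℂ) ^ 2 * ω₀ (ξ + y - η))

/-- The explicit stream-function mode `ψ_m(t,y)` of Theorem 1.1, with
`W(ζ) = W_{0,γ}(2mζ)`. -/
def psiM (β : ℝ) (m : ℕ) (ρ₀ ω₀ : ℝ → ℂ) (t y : ℝ) : ℂ :=
  Complex.exp (-(Complex.I * m * y * t)) * Complex.cos (gam β * (π : ℂ)) / (2 * m * (π : ℂ)) *
    ((∫ η in Set.Ioi (0 : ℝ), Complex.exp (Complex.I * m * η * t) *
        whittW (gam β) (2 * (m : ℂ) * (η : ℂ)) *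
        ∫ ξ in Set.Ioi (0 : ℝ), whittW (gam β) (2 * (m : ℂ) * (ξ : ℂ)) * Gm β m ρ₀ ω₀ η ξ y)
      - ∫ η in Set.Ioi (0 : ℝ), Complex.exp (-(Complex.I * m * η * t)) *
          whittW (gam β) (2 * (m : ℂ) * (η : ℂ)) *
          ∫ ξ in Set.Ioi (0 : ℝ), whittW (gam β) (2 * (m : ℂ) * (ξ : ℂ)) * Gm β m ρ₀ ω₀ (-η) (-ξ) y)

/-- `Q_{j,m}`-type quantity: sum of the `L²` norms of the first `n−1` derivatives of the data. -/
def Qsum (n : ℕ) (ρ₀ ω₀ : ℝ → ℂ) : ℝ≥0∞ :=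
  ∑ k ∈ Finset.range n,
    (eLpNorm (iteratedDeriv k ρ₀) 2 (volume : Measure ℝ)
      + eLpNorm (iteratedDeriv k ω₀) 2 (volume : Measure ℝ))
/-- The explicit density mode `ρ_m(t,y)` of Theorem 1.1, with `W(ζ) = W_{0,γ}(2mζ)`. -/
def rhoM (β : ℝ) (m : ℕ) (ρ₀ ω₀ : ℝ → ℂ) (t y : ℝ) : ℂ :=
  Complex.exp (-(Complex.I * m * y * t)) * Complex.cos (gam β * (π : ℂ)) / (2 * m * (π : ℂ)) *
    ((∫ η in Set.Ioi (0 : ℝ), Complex.exp (Complex.I * m * η * t) *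
        (whittW (gam β) (2 * (m : ℂ) * (η : ℂ)) / (η : ℂ)) *
        ∫ ξ in Set.Ioi (0 : ℝ), whittW (gam β) (2 * (m : ℂ) * (ξ : ℂ)) * Gm β m ρ₀ ω₀ η ξ y)
      + ∫ η in Set.Ioi (0 : ℝ), Complex.exp (-(Complex.I * m * η * t)) *
          (whittW (gam β) (2 * (m : ℂ) * (η : ℂ)) / (η : ℂ)) *
          ∫ ξ in Set.Ioi (0 : ℝ), whittW (gam β) (2 * (m : ℂ) * (ξ : ℂ)) * Gm β m ρ₀ ω₀ (-η) (-ξ) y)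

/-- Maximum principle for `z'' ≤ q z` with `q > 0` on a half-line. -/
theorem nonneg_of_second_deriv_le {X : ℝ} {z z' z'' q : ℝ → ℝ}
    (hz : ∀ x, X ≤ x → HasDerivAt z (z' x) x) (hz' : ∀ x, X ≤ x → HasDerivAt z' (z'' x) x)
    (hq : ∀ x, X ≤ x → 0 < q x) (hle : ∀ x, X ≤ x → z'' x ≤ q x * z x)
    (hX : 0 ≤ z X) (hinf : ∀ᶠ x in Filter.atTop, 0 ≤ z x) {x : ℝ} (hx : X ≤ x) : 0 ≤ z x := by
  by_contra! hneg
  obtain ⟨N, hN, hxN⟩ := (hinf.and (Filter.eventually_ge_atTop x)).exists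
  have hcont : ContinuousOn z (Icc X N) := fun y hy => (hz y hy.1).continuousAt.continuousWithinAt
  obtain ⟨c, hc, hmin⟩ := isCompact_Icc.exists_isMinOn ⟨x, hx, hxN⟩ hcont
  have hzc : z c < 0 := (hmin ⟨hx, hxN⟩).trans_lt hneg
  have hXc : X < c := lt_of_le_of_ne hc.1 (by rintro rfl; linarith)
  have hcN : c < N := lt_of_le_of_ne hc.2 (by rintro rfl; linarith)
  have hloc : IsLocalMin z c := hmin.isLocalMin (Icc_mem_nhds hXc hcN)
  have h0 : z' c = 0 := hloc.hasDerivAt_eq_zero (hz c hc.1)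
  have h2 : z'' c < 0 := (hle c hc.1).trans_lt (mul_neg_of_pos_of_neg (hq c hc.1) hzc)
  have hev : deriv z =ᶠ[nhds c] z' := by
    filter_upwards [Ioi_mem_nhds hXc] with y hy using (hz y (le_of_lt hy)).deriv
  have hdd : deriv (deriv z) c = z'' c := by
    rw [hev.deriv_eq]; exact (hz' c hc.1).deriv
  have hmax : IsLocalMax z c := isLocalMax_of_deriv_deriv_neg (by rw [hdd]; exact h2)
    (by rw [(hz c hc.1).deriv, h0]) (hz c hc.1).continuousAt
  have hconst : z =ᶠ[nhds c] fun _ => z c := by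
    filter_upwards [hmax, hloc] with y h1 h2 using le_antisymm h1 h2
  have : deriv (deriv z) c = 0 := by
    rw [hconst.deriv.deriv_eq]; simp
  linarith

/-- A solution of `u'' = (1/4 - b/x²) u` that is `o(exp (x/2))` at infinity
is exponentially small at infinity, together with its derivative. -/
theorem exp_decay_of_isLittleO {b : ℝ} (hb : 0 < b) {u u' : ℝ → ℂ}
    (hu : ∀ x, 0 < x → HasDerivAt u (u' x) x)
    (hu' : ∀ x, 0 < x → HasDerivAt u' (((1 / 4 - b / x ^ 2 : ℝ) : ℂ) * u x) x)
    (hlim : Filter.Tendsto (fun x : ℝ => Real.exp (-x / 2) * ‖u x‖) Filter.atTop (nhds 0)) :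
    ∃ A X : ℝ, 0 ≤ A ∧ 1 ≤ X ∧ ∀ x, X ≤ x →
      ‖u x‖ ≤ A * Real.exp (-x / 4) ∧ ‖u' x‖ ≤ A * Real.exp (-x / 4) := by
  set X : ℝ := 8 * (1 + b) with hXdef
  have hX8 : 8 ≤ X := by nlinarith
  set A : ℝ := ‖u X‖ * Real.exp (X / 4) with hA
  have hA0 : 0 ≤ A := by positivity
  have hbx : ∀ x, X ≤ x → b / x ^ 2 ≤ 1 / 64 := by
    intro x hx
    rw [div_le_iff₀ (by nlinarith)]
    nlinarith
  have hq : ∀ x, X ≤ x → 0 < 1 / 4 - b / x ^ 2 := fun x hx => by linarith [hbx x hx]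
  have hphi : ∀ x : ℝ, 0 < x → HasDerivAt (fun x => Real.exp (x / 2 + 2 * b / x))
      ((1 / 2 - 2 * b / x ^ 2) * Real.exp (x / 2 + 2 * b / x)) x := by
    intro x hx
    have h1 : HasDerivAt (fun x : ℝ => x / 2 + 2 * b / x) (1 / 2 - 2 * b / x ^ 2) x := by
      simp only [div_eq_mul_inv (2 * b)]
      exact (((hasDerivAt_id x).div_const 2).add
        ((hasDerivAt_inv hx.ne').const_mul (2 * b))).congr_deriv (by ring)
    exact h1.exp.congr_deriv (by ring)
  have hphi' : ∀ x : ℝ, 0 < x →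
      HasDerivAt (fun x => (1 / 2 - 2 * b / x ^ 2) * Real.exp (x / 2 + 2 * b / x))
      ((4 * b / x ^ 3 + (1 / 2 - 2 * b / x ^ 2) ^ 2) * Real.exp (x / 2 + 2 * b / x)) x := by
    intro x hx
    have h1 : HasDerivAt (fun x : ℝ => 1 / 2 - 2 * b / x ^ 2) (4 * b / x ^ 3) x := by
      simp only [div_eq_mul_inv (2 * b)]
      refine ((((hasDerivAt_pow 2 x).inv (by positivity)).const_mul (2 * b)).const_sub
        (1 / 2)).congr_deriv ?_
      field_simp
      push_cast
      ring
    exact (h1.mul (hphi x hx)).congr_deriv (by ring)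
  have hpsi : ∀ x : ℝ, HasDerivAt (fun x => Real.exp (-x / 4)) (-(1 / 4) * Real.exp (-x / 4)) x := by
    intro x
    have h1 : HasDerivAt (fun x : ℝ => -x / 4) (-1 / 4) x := (hasDerivAt_neg x).div_const 4
    convert h1.exp using 1
    ring
  have key : ∀ ε : ℝ, 0 < ε → ∀ x, X ≤ x →
      ‖u x‖ ≤ A * Real.exp (-x / 4) + ε * Real.exp (x / 2 + 2 * b / x) := by
    intro ε hε x hx
    obtain ⟨v, hv, hvx⟩ : ∃ v : ℂ, ‖v‖ ≤ 1 ∧ (v * u x).re = ‖u x‖ := by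
      by_cases h : u x = 0
      · exact ⟨0, by simp, by simp [h]⟩
      · refine ⟨(starRingEnd ℂ) (u x) / ‖u x‖, ?_, ?_⟩
        · simp [h]
        · rw [div_mul_eq_mul_div, mul_comm, Complex.mul_conj, Complex.normSq_eq_norm_sq,
            ← Complex.ofReal_div, Complex.ofReal_re]
          have : ‖u x‖ ≠ 0 := by simpa using h
          field_simp
    have hre : ∀ y, (v * u y).re ≤ ‖u y‖ := fun y => (Complex.re_le_norm _).trans (by
      rw [norm_mul]; exact mul_le_of_le_one_left (norm_nonneg _) hv)
    have hder : ∀ {f : ℝ → ℂ} {f' : ℂ} {y : ℝ}, HasDerivAt f f' y →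
        HasDerivAt (fun y => (v * f y).re) (v * f').re y := by
      intro f f' y h
      exact Complex.reCLM.hasFDerivAt.comp_hasDerivAt y (h.const_mul v)
    have := nonneg_of_second_deriv_le (X := X)
      (z := fun y => A * Real.exp (-y / 4) + ε * Real.exp (y / 2 + 2 * b / y) - (v * u y).re)
      (z' := fun y => A * (-(1 / 4) * Real.exp (-y / 4)) +
        ε * ((1 / 2 - 2 * b / y ^ 2) * Real.exp (y / 2 + 2 * b / y)) - (v * u' y).re)
      (z'' := fun y => A * (-(1 / 4) * (-(1 / 4) * Real.exp (-y / 4))) +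
        ε * ((4 * b / y ^ 3 + (1 / 2 - 2 * b / y ^ 2) ^ 2) * Real.exp (y / 2 + 2 * b / y)) -
        (v * (((1 / 4 - b / y ^ 2 : ℝ) : ℂ) * u y)).re)
      (q := fun y => 1 / 4 - b / y ^ 2) ?_ ?_ hq ?_ ?_ ?_ hx
    · rw [hvx] at this; linarith
    · intro y hy
      have hy0 : 0 < y := by linarith
      exact (((hpsi y).const_mul A).add ((hphi y hy0).const_mul ε)).sub (hder (hu y hy0))
    · intro y hy
      have hy0 : 0 < y := by linarith
      exact ((((hpsi y).const_mul _).const_mul A).add ((hphi' y hy0).const_mul ε)).sub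
        (hder (hu' y hy0))
    · intro y hy
      have hy0 : 0 < y := by linarith
      have e1 : (v * (((1 / 4 - b / y ^ 2 : ℝ) : ℂ) * u y)).re
          = (1 / 4 - b / y ^ 2) * (v * u y).re := by
        rw [mul_left_comm, Complex.re_ofReal_mul]
      have e2 : A * (-(1 / 4) * (-(1 / 4) * Real.exp (-y / 4))) ≤
          (1 / 4 - b / y ^ 2) * (A * Real.exp (-y / 4)) := by
        have : 0 ≤ A * Real.exp (-y / 4) := by positivity
        nlinarith [hbx y hy]
      have e3 : 4 * b / y ^ 3 + (1 / 2 - 2 * b / y ^ 2) ^ 2 ≤ 1 / 4 - b / y ^ 2 := by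
        have h1 : b / y ^ 2 ≤ 1 / 64 := hbx y hy
        have h2 : 4 * b / y ^ 3 ≤ b / y ^ 2 / 2 := by
          rw [div_div, div_le_div_iff₀ (by positivity) (by positivity)]
          have : b * y ^ 2 * 8 ≤ b * y ^ 2 * y :=
            mul_le_mul_of_nonneg_left (by linarith) (by positivity)
          nlinarith
        have h3 : 0 ≤ b / y ^ 2 := by positivity
        have h4 : 2 * b / y ^ 2 = 2 * (b / y ^ 2) := by ring
        rw [h4]
        nlinarith
      have e4 : ε * ((4 * b / y ^ 3 + (1 / 2 - 2 * b / y ^ 2) ^ 2) *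
          Real.exp (y / 2 + 2 * b / y)) ≤
          (1 / 4 - b / y ^ 2) * (ε * Real.exp (y / 2 + 2 * b / y)) := by
        rw [mul_left_comm (1 / 4 - b / y ^ 2)]
        gcongr
      simp only [e1]
      linarith
    · have h1 : A * Real.exp (-X / 4) = ‖u X‖ := by
        rw [hA, mul_assoc, ← Real.exp_add]; simp [neg_div]
      have h2 := hre X
      have h3 : 0 ≤ ε * Real.exp (X / 2 + 2 * b / X) := by positivity
      simp only [h1]; linarith
    · filter_upwards [hlim.eventually_le_const hε, Filter.eventually_gt_atTop 0] with y hy hy0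
      have h1 : ‖u y‖ ≤ ε * Real.exp (y / 2) := by
        have : ‖u y‖ = Real.exp (-y / 2) * ‖u y‖ * Real.exp (y / 2) := by
          rw [mul_right_comm, ← Real.exp_add]; simp [neg_div]
        rw [this]; gcongr
      have h2 : Real.exp (y / 2) ≤ Real.exp (y / 2 + 2 * b / y) :=
        Real.exp_le_exp.2 (by have : 0 < 2 * b / y := by positivity
                              linarith)
      have h3 : 0 ≤ A * Real.exp (-y / 4) := by positivity
      have h4 := mul_le_mul_of_nonneg_left h2 hε.le
      linarith [hre y]
  have hdec : ∀ x, X ≤ x → ‖u x‖ ≤ A * Real.exp (-x / 4) := by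
    intro x hx
    refine le_of_forall_pos_le_add fun ε hε => ?_
    have := key (ε / Real.exp (x / 2 + 2 * b / x)) (by positivity) x hx
    rwa [div_mul_cancel₀ _ (Real.exp_pos _).ne'] at this
  refine ⟨3 * A, X, by positivity, by linarith, fun x hx => ⟨?_, ?_⟩⟩
  · have := hdec x hx
    have h0 : 0 ≤ A * Real.exp (-x / 4) := by positivity
    linarith
  · have hu2 : ∀ y ∈ Icc x (x + 1), ‖((1 / 4 - b / y ^ 2 : ℝ) : ℂ) * u y‖ ≤
        A * Real.exp (-x / 4) := by
      intro y hy
      have hXy := hx.trans hy.1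
      rw [norm_mul, Complex.norm_real, Real.norm_of_nonneg (hq y hXy).le]
      have h1 : 0 ≤ b / y ^ 2 := by positivity
      have h2 : Real.exp (-y / 4) ≤ Real.exp (-x / 4) :=
        Real.exp_le_exp.2 (by linarith [hy.1])
      have h3 : ‖u y‖ ≤ A * Real.exp (-x / 4) := (hdec y hXy).trans (by gcongr)
      nlinarith [norm_nonneg (u y)]
    have hu1 : ∀ y ∈ Icc x (x + 1), ‖u' y - u' x‖ ≤ A * Real.exp (-x / 4) := by
      intro y hy
      have := norm_image_sub_le_of_norm_deriv_le_segment_01' (E := ℂ)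
        (f := fun s => u' (x + s * (y - x))) (C := A * Real.exp (-x / 4))
        (f' := fun s => (y - x) •
          (((1 / 4 - b / (x + s * (y - x)) ^ 2 : ℝ) : ℂ) * u (x + s * (y - x)))) ?_ ?_
      · simpa using this
      · intro s hs
        have hpos : 0 < x + s * (y - x) := by
          have := mul_nonneg hs.1 (sub_nonneg.2 hy.1)
          linarith
        have hl : HasDerivAt (fun s : ℝ => x + s * (y - x)) (y - x) s := by
          simpa using ((hasDerivAt_id s).mul_const (y - x)).const_add x
        exact ((hu' _ hpos).scomp s hl).hasDerivWithinAt
      · intro s hs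
        have h1 := mul_nonneg hs.1 (sub_nonneg.2 hy.1)
        have h2 : s * (y - x) ≤ 1 := by
          have := hs.2.le; nlinarith [hy.1, hy.2, hs.1]
        rw [norm_smul, Real.norm_of_nonneg (sub_nonneg.2 hy.1)]
        have := hu2 (x + s * (y - x)) ⟨by linarith, by linarith⟩
        have h3 : y - x ≤ 1 := by linarith [hy.2]
        calc _ ≤ 1 * (A * Real.exp (-x / 4)) := by
              gcongr
          _ = _ := one_mul _
    have h3 : ‖u (x + 1) - u x - u' x‖ ≤ A * Real.exp (-x / 4) := by
      have := norm_image_sub_le_of_norm_deriv_le_segment' (E := ℂ)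
        (f := fun y => u y - (y - x) • u' x) (C := A * Real.exp (-x / 4))
        (f' := fun y => u' y - u' x) (a := x) (b := x + 1) ?_ ?_ (x + 1) ⟨by linarith, le_rfl⟩
      · simpa [sub_right_comm] using this
      · intro y hy
        have hl : HasDerivAt (fun y : ℝ => (y - x) • u' x) (u' x) y := by
          simpa using ((hasDerivAt_id y).sub_const x).smul_const (u' x)
        exact ((hu y (by linarith [hy.1])).sub hl).hasDerivWithinAt
      · intro y hy
        exact hu1 y ⟨hy.1, hy.2.le⟩
    have h4 := hdec x hx
    have h5 := hdec (x + 1) (by linarith)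
    have h6 : Real.exp (-(x + 1) / 4) ≤ Real.exp (-x / 4) := Real.exp_le_exp.2 (by linarith)
    have h7 := mul_le_mul_of_nonneg_left h6 hA0
    have h8 : u' x = u (x + 1) - u x - (u (x + 1) - u x - u' x) := by ring
    rw [h8]
    refine (norm_sub_le _ _).trans ?_
    have := norm_sub_le (u (x + 1)) (u x)
    linarith

/-- The weight `u^(a-1) (1-u)^(a-1)` of Euler's Beta integral. -/
def betaWeight (a : ℂ) (u : ℝ) : ℂ := (u : ℂ) ^ (a - 1) * (1 - (u : ℂ)) ^ (a - 1)

/-- The two-sided Laplace transform of a function on `[0, 1]`. -/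
def laplaceUnit (φ : ℝ → ℂ) (x : ℝ) : ℂ := ∫ u in (0 : ℝ)..1, (Real.exp (x * u) : ℂ) * φ u

theorem intervalIntegrable_betaWeight {a : ℂ} (ha : 0 < a.re) :
    IntervalIntegrable (betaWeight a) volume 0 1 :=
  Complex.betaIntegral_convergent ha ha

theorem intervalIntegrable_exp_mul {φ : ℝ → ℂ} (hφ : IntervalIntegrable φ volume 0 1) (x : ℝ) :
    IntervalIntegrable (fun u => (Real.exp (x * u) : ℂ) * φ u) volume 0 1 :=
  hφ.continuousOn_mul (by fun_prop)

theorem intervalIntegrable_id_mul {φ : ℝ → ℂ} (hφ : IntervalIntegrable φ volume 0 1) :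
    IntervalIntegrable (fun u => (u : ℂ) * φ u) volume 0 1 :=
  hφ.continuousOn_mul (by fun_prop)

theorem norm_laplaceUnit_le {φ : ℝ → ℂ} (hφ : IntervalIntegrable φ volume 0 1) {x : ℝ}
    (hx : 0 ≤ x) : ‖laplaceUnit φ x‖ ≤ Real.exp x * ∫ u in (0 : ℝ)..1, ‖φ u‖ := by
  rw [laplaceUnit, ← intervalIntegral.integral_const_mul]
  refine intervalIntegral.norm_integral_le_of_norm_le zero_le_one ?_ (hφ.norm.const_mul _)
  refine Filter.Eventually.of_forall fun u hu => ?_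
  rw [norm_mul, Complex.norm_real, Real.norm_of_nonneg (Real.exp_pos _).le]
  gcongr
  nlinarith [hu.1, hu.2]

theorem hasDerivAt_laplaceUnit {φ : ℝ → ℂ} (hφ : IntervalIntegrable φ volume 0 1) (x : ℝ) :
    HasDerivAt (laplaceUnit φ) (laplaceUnit (fun u => (u : ℂ) * φ u) x) x := by
  refine (intervalIntegral.hasDerivAt_integral_of_dominated_loc_of_deriv_le
    (F := fun x u => (Real.exp (x * u) : ℂ) * φ u)
    (F' := fun x u => (Real.exp (x * u) : ℂ) * ((u : ℂ) * φ u))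
    (bound := fun u => Real.exp (|x| + 1) * ‖φ u‖)
    (Metric.ball_mem_nhds x one_pos)
    (Filter.Eventually.of_forall fun y => (intervalIntegrable_exp_mul hφ y).def'.aestronglyMeasurable)
    (intervalIntegrable_exp_mul hφ x)
    (intervalIntegrable_exp_mul (intervalIntegrable_id_mul hφ) x).def'.aestronglyMeasurable
    ?_ (hφ.norm.const_mul _) ?_).2
  · refine Filter.Eventually.of_forall fun u hu y hy => ?_
    rw [uIoc_of_le zero_le_one] at hu
    rw [norm_mul, norm_mul, Complex.norm_real, Complex.norm_real,
      Real.norm_of_nonneg (Real.exp_pos _).le, Real.norm_of_nonneg hu.1.le]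
    have h1 : |y| ≤ |x| + 1 := by
      have := abs_sub_abs_le_abs_sub y x
      rw [Metric.mem_ball, Real.dist_eq] at hy
      linarith
    have h2 : y * u ≤ |x| + 1 := by
      have := le_abs_self y
      have := abs_nonneg y
      nlinarith [hu.1, hu.2]
    have h3 : u * ‖φ u‖ ≤ ‖φ u‖ := mul_le_of_le_one_left (norm_nonneg _) hu.2
    have h4 : 0 ≤ u * ‖φ u‖ := mul_nonneg hu.1.le (norm_nonneg _)
    gcongr
  · refine Filter.Eventually.of_forall fun u hu y hy => ?_
    have h1 : HasDerivAt (fun y : ℝ => Real.exp (y * u)) (Real.exp (y * u) * u) y := by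
      simpa using ((hasDerivAt_id y).mul_const u).exp
    refine (h1.ofReal_comp.mul_const (φ u)).congr_deriv ?_
    push_cast
    ring

/-- Kummer's equation for the Euler integral. -/
theorem laplaceUnit_betaWeight_kummer {a : ℂ} (ha : 0 < a.re) (x : ℝ) :
    (x : ℂ) * laplaceUnit (fun u => (u : ℂ) * ((u : ℂ) * betaWeight a u)) x =
      (x - 2 * a) * laplaceUnit (fun u => (u : ℂ) * betaWeight a u) x
        + a * laplaceUnit (betaWeight a) x := by
  have hw := intervalIntegrable_betaWeight ha
  have hw1 := intervalIntegrable_id_mul hw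
  have hw2 := intervalIntegrable_id_mul hw1
  have ha0 : a ≠ 0 := by rintro rfl; simp at ha
  have key : ∫ u in (0 : ℝ)..1, ((x - 2 * a) * ((Real.exp (x * u) : ℂ) * ((u : ℂ) * betaWeight a u))
      + a * ((Real.exp (x * u) : ℂ) * betaWeight a u)
      - x * ((Real.exp (x * u) : ℂ) * ((u : ℂ) * ((u : ℂ) * betaWeight a u)))) = 0 := by
    rw [intervalIntegral.integral_eq_sub_of_hasDerivAt_of_le zero_le_one
      (f := fun u : ℝ => (Real.exp (x * u) : ℂ) * ((u : ℂ) ^ a * (1 - (u : ℂ)) ^ a))]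
    · simp [ha0]
    · have h1 : ContinuousOn (fun u : ℝ => (u : ℂ) ^ a) (Icc 0 1) :=
        (Complex.continuous_ofReal_cpow_const ha).continuousOn
      have h2 : ContinuousOn (fun u : ℝ => (1 - (u : ℂ)) ^ a) (Icc 0 1) := by
        have := (Complex.continuous_ofReal_cpow_const ha).comp (continuous_const.sub continuous_id :
          Continuous fun u : ℝ => 1 - u)
        simpa [Function.comp_def] using this.continuousOn
      exact ContinuousOn.mul (by fun_prop) (h1.mul h2)
    · intro u hu
      have hu0 : (u : ℂ) ≠ 0 := by exact_mod_cast hu.1.ne'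
      have hu1 : (1 - (u : ℂ)) ≠ 0 := by
        have := (sub_pos.2 hu.2).ne'
        exact_mod_cast this
      have h0 : HasDerivAt (fun u : ℝ => (Real.exp (x * u) : ℂ)) (x * Real.exp (x * u) : ℂ) u := by
        have : HasDerivAt (fun u : ℝ => Real.exp (x * u)) (Real.exp (x * u) * x) u := by
          simpa using ((hasDerivAt_id u).const_mul x).exp
        refine this.ofReal_comp.congr_deriv ?_
        push_cast; ring
      have h1 : HasDerivAt (fun u : ℝ => (u : ℂ) ^ a) (a * (u : ℂ) ^ (a - 1)) u := by
        have := (hasDerivAt_id (u : ℂ)).cpow_const (c := a) (Or.inl (by simpa using hu.1))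
        simpa using this.comp_ofReal
      have h2 : HasDerivAt (fun u : ℝ => (1 - (u : ℂ)) ^ a) (-(a * (1 - (u : ℂ)) ^ (a - 1))) u := by
        have := ((hasDerivAt_id (u : ℂ)).const_sub 1).cpow_const (c := a)
          (Or.inl (by simpa using hu.2))
        simpa using this.comp_ofReal
      refine (h0.mul (h1.mul h2)).congr_deriv ?_
      have e1 : (u : ℂ) ^ a = (u : ℂ) ^ (a - 1) * u := by
        rw [Complex.cpow_sub _ _ hu0, Complex.cpow_one]; field_simp
      have e2 : (1 - (u : ℂ)) ^ a = (1 - (u : ℂ)) ^ (a - 1) * (1 - u) := by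
        rw [Complex.cpow_sub _ _ hu1, Complex.cpow_one]; field_simp
      simp only [Pi.mul_apply, e1, e2, betaWeight]
      ring
    · exact (((intervalIntegrable_exp_mul hw1 x).const_mul _).add
        ((intervalIntegrable_exp_mul hw x).const_mul _)).sub
        ((intervalIntegrable_exp_mul hw2 x).const_mul _)
  rw [intervalIntegral.integral_sub (((intervalIntegrable_exp_mul hw1 x).const_mul _).add
        ((intervalIntegrable_exp_mul hw x).const_mul _))
        ((intervalIntegrable_exp_mul hw2 x).const_mul _),
    intervalIntegral.integral_add ((intervalIntegrable_exp_mul hw1 x).const_mul _)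
        ((intervalIntegrable_exp_mul hw x).const_mul _),
    intervalIntegral.integral_const_mul, intervalIntegral.integral_const_mul,
    intervalIntegral.integral_const_mul] at key
  exact (sub_eq_zero.1 key).symm

theorem Gamma_add_natCast_eq_poch_mul {a : ℂ} (ha : 0 < a.re) (s : ℕ) :
    Complex.Gamma (a + s) = poch a s * Complex.Gamma a := by
  induction s with
  | zero => simp [poch]
  | succ s ih =>
    have h : a + s ≠ 0 := by
      intro h
      have := congrArg Complex.re h
      simp at this
      have : (0 : ℝ) ≤ s := s.cast_nonneg
      linarith
    rw [Nat.cast_succ, ← add_assoc, Complex.Gamma_add_one _ h, ih, poch, poch,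
      Finset.prod_range_succ]
    ring

/-- Euler's integral for `M(a, 2a, x)`. -/
theorem betaIntegral_mul_chgM {a : ℂ} (ha : 0 < a.re) (x : ℝ) :
    Complex.betaIntegral a a * chgM a (2 * a) x = laplaceUnit (betaWeight a) x := by
  have hw := intervalIntegrable_betaWeight ha
  have ha2 : 0 < (2 * a).re := by simpa using ha
  have hterm : ∀ s : ℕ, ∫ u in (0 : ℝ)..1, ((x : ℂ) ^ s / (s.factorial : ℂ)) * ((u : ℂ) ^ s * betaWeight a u)
      = Complex.betaIntegral a a *
        (poch a s / (poch (2 * a) s * (s.factorial : ℂ)) * (x : ℂ) ^ s) := by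
    intro s
    have has : 0 < (a + s).re := by
      have : (0 : ℝ) ≤ s := s.cast_nonneg
      simp; linarith
    have h1 : ∫ u in (0 : ℝ)..1, (u : ℂ) ^ s * betaWeight a u = Complex.betaIntegral (a + s) a := by
      rw [Complex.betaIntegral]
      refine intervalIntegral.integral_congr_ae (Filter.Eventually.of_forall fun u hu => ?_)
      rw [uIoc_of_le zero_le_one] at hu
      have hu0 : (u : ℂ) ≠ 0 := by exact_mod_cast hu.1.ne'
      rw [betaWeight, ← mul_assoc, ← Complex.cpow_natCast, ← Complex.cpow_add _ _ hu0]
      congr 2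
      ring
    rw [intervalIntegral.integral_const_mul, h1]
    have h2 := Complex.Gamma_mul_Gamma_eq_betaIntegral has ha
    have h3 := Complex.Gamma_mul_Gamma_eq_betaIntegral ha ha
    rw [show a + s + a = 2 * a + s by ring, Gamma_add_natCast_eq_poch_mul ha,
      Gamma_add_natCast_eq_poch_mul ha2] at h2
    rw [← two_mul] at h3
    have hG2 : Complex.Gamma (2 * a) ≠ 0 := Complex.Gamma_ne_zero_of_re_pos ha2
    have hp : poch (2 * a) s ≠ 0 := by
      intro h
      have h4 := Gamma_add_natCast_eq_poch_mul ha2 s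
      rw [h, zero_mul] at h4
      refine Complex.Gamma_ne_zero_of_re_pos ?_ h4
      have : (0 : ℝ) ≤ s := s.cast_nonneg
      simp at ha2 ⊢; linarith
    have h5 : poch (2 * a) s * Complex.betaIntegral (a + s) a
        = poch a s * Complex.betaIntegral a a := by
      apply mul_left_cancel₀ hG2
      linear_combination poch a s * h3 - h2
    have h6 : Complex.betaIntegral (a + s) a
        = poch a s * Complex.betaIntegral a a / poch (2 * a) s := by
      rw [eq_div_iff hp, ← h5]; ring
    have hf : (s.factorial : ℂ) ≠ 0 := by exact_mod_cast s.factorial_ne_zero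
    rw [h6]
    field_simp
  have hsum := intervalIntegral.hasSum_integral_of_dominated_convergence
    (μ := volume) (a := 0) (b := 1)
    (F := fun (s : ℕ) (u : ℝ) => ((x : ℂ) ^ s / (s.factorial : ℂ)) * ((u : ℂ) ^ s * betaWeight a u))
    (f := fun u => (Real.exp (x * u) : ℂ) * betaWeight a u)
    (fun s u => |x| ^ s / (s.factorial : ℝ) * ‖betaWeight a u‖) ?_ ?_ ?_ ?_ ?_
  · rw [laplaceUnit, ← hsum.tsum_eq, chgM, ← tsum_mul_left]
    exact tsum_congr fun s => (hterm s).symm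
  · intro s
    exact ((hw.continuousOn_mul (g := fun u : ℝ => (u : ℂ) ^ s) (by fun_prop)).const_mul
      _).def'.aestronglyMeasurable
  · refine fun s => Filter.Eventually.of_forall fun u hu => ?_
    rw [uIoc_of_le zero_le_one] at hu
    simp only [norm_mul, norm_div, norm_pow, Complex.norm_real, Real.norm_eq_abs,
      Complex.norm_natCast]
    rw [abs_of_pos hu.1]
    have : u ^ s * ‖betaWeight a u‖ ≤ ‖betaWeight a u‖ :=
      mul_le_of_le_one_left (norm_nonneg _) (pow_le_one₀ hu.1.le hu.2)
    gcongr
  · exact Filter.Eventually.of_forall fun u _ => (Real.summable_pow_div_factorial |x|).mul_right _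
  · simp_rw [tsum_mul_right]
    exact hw.norm.const_mul _
  · refine Filter.Eventually.of_forall fun u _ => ?_
    have h := NormedSpace.expSeries_div_hasSum_exp ((x * u : ℝ) : ℂ)
    rw [← Complex.exp_eq_exp_ℂ, ← Complex.ofReal_exp] at h
    have h2 := h.mul_right (betaWeight a u)
    have h3 : (fun s : ℕ => ((x : ℂ) ^ s / (s.factorial : ℂ)) * ((u : ℂ) ^ s * betaWeight a u))
        = fun s : ℕ => ((x * u : ℝ) : ℂ) ^ s / (s.factorial : ℂ) * betaWeight a u := by
      funext s
      push_cast
      rw [mul_pow]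
      ring
    rw [h3]
    exact h2

/-- Watson's lemma, leading order. -/
theorem tendsto_cpow_mul_laplace {a : ℂ} (ha : 0 < a.re) {g : ℝ → ℂ} (hg : Measurable g) {K : ℝ}
    (hK : ∀ u, ‖g u‖ ≤ K) (hlim : Filter.Tendsto g (nhds 0) (nhds 1)) :
    Filter.Tendsto (fun x : ℝ => (x : ℂ) ^ a *
      ∫ u in Ioi (0 : ℝ), (Real.exp (-x * u) : ℂ) * (u : ℂ) ^ (a - 1) * g u)
      Filter.atTop (nhds (Complex.Gamma a)) := by
  have hT : Filter.Tendsto (fun x : ℝ => ∫ v in Ioi (0 : ℝ),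
      (Real.exp (-v) : ℂ) * (v : ℂ) ^ (a - 1) * g (v / x)) Filter.atTop
      (nhds (∫ v in Ioi (0 : ℝ), (Real.exp (-v) : ℂ) * (v : ℂ) ^ (a - 1) * 1)) := by
    refine tendsto_integral_filter_of_dominated_convergence
      (fun v => Real.exp (-v) * v ^ (a.re - 1) * K) ?_ ?_
      ((Real.GammaIntegral_convergent ha).mul_const K) ?_
    · refine Filter.Eventually.of_forall fun x => Measurable.aestronglyMeasurable ?_
      have : Measurable fun v : ℝ => g (v / x) := hg.comp (by fun_prop)
      fun_prop
    · refine Filter.Eventually.of_forall fun x => ?_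
      filter_upwards [ae_restrict_mem measurableSet_Ioi] with v hv
      rw [norm_mul, norm_mul, Complex.norm_real, Real.norm_of_nonneg (Real.exp_pos _).le,
        Complex.norm_cpow_eq_rpow_re_of_pos hv, Complex.sub_re, Complex.one_re]
      gcongr
      · exact mul_nonneg (Real.exp_pos _).le (Real.rpow_nonneg (le_of_lt hv) _)
      · exact hK _
    · refine Filter.Eventually.of_forall fun v => ?_
      exact (hlim.comp (Filter.tendsto_id.const_div_atTop v)).const_mul _
  have hG : ∫ v in Ioi (0 : ℝ), (Real.exp (-v) : ℂ) * (v : ℂ) ^ (a - 1) * 1 = Complex.Gamma a := by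
    rw [Complex.Gamma_eq_integral ha, Complex.GammaIntegral]
    simp
  rw [hG] at hT
  refine hT.congr' ?_
  filter_upwards [Filter.eventually_gt_atTop 0] with x hx
  have hx0 : (x : ℂ) ≠ 0 := by exact_mod_cast hx.ne'
  have h1 := integral_comp_mul_left_Ioi'
    (fun v : ℝ => (Real.exp (-v) : ℂ) * (v : ℂ) ^ (a - 1) * g (v / x)) 0 hx
  rw [mul_zero] at h1
  rw [← h1, Complex.real_smul, ← integral_const_mul, ← integral_const_mul]
  refine setIntegral_congr_fun measurableSet_Ioi fun u hu => ?_
  have hu0 : (0 : ℝ) ≤ u := le_of_lt hu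
  simp only [Complex.ofReal_mul x u, Complex.mul_cpow_ofReal_nonneg hx.le hu0,
    mul_div_cancel_left₀ u hx.ne', neg_mul]
  rw [Complex.cpow_sub _ _ hx0, Complex.cpow_one]
  field_simp

theorem laplaceUnit_betaWeight_neg (a : ℂ) (x : ℝ) :
    laplaceUnit (betaWeight a) (-x) = (Real.exp (-x) : ℂ) * laplaceUnit (betaWeight a) x := by
  have h := intervalIntegral.integral_comp_sub_left (a := 0) (b := 1)
    (fun u : ℝ => (Real.exp (-x * u) : ℂ) * betaWeight a u) 1
  rw [sub_self, sub_zero] at h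
  rw [laplaceUnit, ← h, laplaceUnit, ← intervalIntegral.integral_const_mul]
  refine intervalIntegral.integral_congr fun u _ => ?_
  have h1 : Real.exp (-x * (1 - u)) = Real.exp (-x) * Real.exp (x * u) := by
    rw [← Real.exp_add]; ring_nf
  simp only [h1, betaWeight]
  push_cast
  rw [sub_sub_cancel]
  ring

theorem tendsto_cpow_mul_laplaceUnit_neg {a : ℂ} (ha : 0 < a.re) (ha1 : a.re < 1) :
    Filter.Tendsto (fun x : ℝ => (x : ℂ) ^ a * laplaceUnit (betaWeight a) (-x))
      Filter.atTop (nhds (Complex.Gamma a)) := by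
  have hw := intervalIntegrable_betaWeight ha
  set g : ℝ → ℂ := (Iic (1 / 2 : ℝ)).indicator fun u => (1 - (u : ℂ)) ^ (a - 1) with hg
  have hgm : Measurable g := Measurable.indicator (by fun_prop) measurableSet_Iic
  have hgK : ∀ u, ‖g u‖ ≤ (1 / 2 : ℝ) ^ (a.re - 1) := by
    intro u
    by_cases hu : u ∈ Iic (1 / 2 : ℝ)
    · have hu' : u ≤ 1 / 2 := hu
      have e : (1 - (u : ℂ)) = ((1 - u : ℝ) : ℂ) := by push_cast; rfl
      rw [hg, indicator_of_mem hu, e, Complex.norm_cpow_eq_rpow_re_of_pos (by linarith)]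
      exact Real.rpow_le_rpow_of_nonpos (by norm_num) (by linarith) (by simp; linarith)
    · rw [hg, indicator_of_notMem hu, norm_zero]
      positivity
  have hglim : Filter.Tendsto g (nhds 0) (nhds 1) := by
    have h1 : Filter.Tendsto (fun u : ℝ => (1 - (u : ℂ)) ^ (a - 1)) (nhds 0) (nhds 1) := by
      have hc : ContinuousAt (fun u : ℝ => (1 - (u : ℂ)) ^ (a - 1)) 0 :=
        ContinuousAt.cpow (by fun_prop) continuousAt_const (by simp)
      simpa [ContinuousAt] using hc
    refine h1.congr' ?_
    filter_upwards [Iio_mem_nhds (show (0 : ℝ) < 1 / 2 by norm_num)] with u hu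
    rw [hg, indicator_of_mem (mem_Iic.2 (le_of_lt (mem_Iio.1 hu)))]
  have hA := tendsto_cpow_mul_laplace ha hgm hgK hglim
  have hB : Filter.Tendsto (fun x : ℝ => (x : ℂ) ^ a *
      ∫ u in (1 / 2 : ℝ)..1, (Real.exp (-x * u) : ℂ) * betaWeight a u)
      Filter.atTop (nhds 0) := by
    have hw' : IntervalIntegrable (betaWeight a) volume (1 / 2) 1 :=
      hw.mono_set (by rw [uIcc_of_le (by norm_num), uIcc_of_le (by norm_num)]
                      exact Icc_subset_Icc_left (by norm_num))
    have hlim := (tendsto_rpow_mul_exp_neg_mul_atTop_nhds_zero a.re (1 / 2) (by norm_num)).mul_const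
      (∫ u in (1 / 2 : ℝ)..1, ‖betaWeight a u‖)
    rw [zero_mul] at hlim
    refine squeeze_zero_norm' ?_ hlim
    filter_upwards [Filter.eventually_gt_atTop 0] with x hx
    rw [norm_mul, Complex.norm_cpow_eq_rpow_re_of_pos hx, mul_assoc]
    gcongr
    rw [← intervalIntegral.integral_const_mul]
    refine intervalIntegral.norm_integral_le_of_norm_le (by norm_num) ?_ (hw'.norm.const_mul _)
    refine Filter.Eventually.of_forall fun u hu => ?_
    rw [norm_mul, Complex.norm_real, Real.norm_of_nonneg (Real.exp_pos _).le]
    refine mul_le_mul_of_nonneg_right (Real.exp_le_exp.2 ?_) (norm_nonneg _)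
    nlinarith [hu.1]
  have hAB := hA.add hB
  rw [add_zero] at hAB
  refine hAB.congr fun x => ?_
  rw [← mul_add]
  congr 1
  have hi := intervalIntegrable_exp_mul hw (-x)
  have hs1 : uIcc (0 : ℝ) (1 / 2) ⊆ uIcc 0 1 := by
    rw [uIcc_of_le (by norm_num), uIcc_of_le (by norm_num)]
    exact Icc_subset_Icc_right (by norm_num)
  have hs2 : uIcc (1 / 2 : ℝ) 1 ⊆ uIcc 0 1 := by
    rw [uIcc_of_le (by norm_num), uIcc_of_le (by norm_num)]
    exact Icc_subset_Icc_left (by norm_num)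
  rw [laplaceUnit, ← intervalIntegral.integral_add_adjacent_intervals
    (hi.mono_set hs1) (hi.mono_set hs2)]
  congr 1
  rw [intervalIntegral.integral_of_le (by norm_num), ← Ioi_inter_Iic,
    ← setIntegral_indicator measurableSet_Iic]
  refine integral_congr_ae (Filter.Eventually.of_forall fun u => ?_)
  by_cases hu : u ∈ Iic (1 / 2 : ℝ)
  · simp only [hg, indicator_of_mem hu, betaWeight, mul_assoc]
  · simp only [hg, indicator_of_notMem hu, mul_zero]

/-- The regular solution `e^{-x/2} x^a J_a(x)` of Whittaker's equation, where `J_a` is Euler's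
integral. -/
def whittP (a : ℂ) (x : ℝ) : ℂ :=
  (Real.exp (-x / 2) : ℂ) * (x : ℂ) ^ a * laplaceUnit (betaWeight a) x

/-- The derivative of `whittP`. -/
def whittP' (a : ℂ) (x : ℝ) : ℂ :=
  (Real.exp (-x / 2) : ℂ) * (x : ℂ) ^ a * (laplaceUnit (fun u => (u : ℂ) * betaWeight a u) x
    + (a / x - 1 / 2) * laplaceUnit (betaWeight a) x)

theorem hasDerivAt_exp_mul_cpow (a : ℂ) {x : ℝ} (hx : 0 < x) :
    HasDerivAt (fun x : ℝ => (Real.exp (-x / 2) : ℂ) * (x : ℂ) ^ a)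
      ((Real.exp (-x / 2) : ℂ) * (x : ℂ) ^ a * (a / x - 1 / 2)) x := by
  have hx0 : (x : ℂ) ≠ 0 := by exact_mod_cast hx.ne'
  have h0 : HasDerivAt (fun x : ℝ => (Real.exp (-x / 2) : ℂ))
      ((Real.exp (-x / 2) * (-1 / 2) : ℝ) : ℂ) x :=
    (((hasDerivAt_neg x).div_const 2).exp).ofReal_comp
  have h1 : HasDerivAt (fun u : ℝ => (u : ℂ) ^ a) (a * (x : ℂ) ^ (a - 1)) x := by
    have := (hasDerivAt_id (x : ℂ)).cpow_const (c := a) (Or.inl (by simpa using hx))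
    simpa using this.comp_ofReal
  refine (h0.mul h1).congr_deriv ?_
  rw [Complex.cpow_sub _ _ hx0, Complex.cpow_one]
  push_cast
  field_simp
  ring

theorem hasDerivAt_whittP {a : ℂ} (ha : 0 < a.re) {x : ℝ} (hx : 0 < x) :
    HasDerivAt (whittP a) (whittP' a x) x := by
  refine ((hasDerivAt_exp_mul_cpow a hx).mul
    (hasDerivAt_laplaceUnit (intervalIntegrable_betaWeight ha) x)).congr_deriv ?_
  rw [whittP']
  ring

theorem hasDerivAt_whittP' {a : ℂ} (ha : 0 < a.re) {x : ℝ} (hx : 0 < x) :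
    HasDerivAt (whittP' a) ((1 / 4 - a * (1 - a) / x ^ 2) * whittP a x) x := by
  have hx0 : (x : ℂ) ≠ 0 := by exact_mod_cast hx.ne'
  have hw := intervalIntegrable_betaWeight ha
  have h2 : HasDerivAt (fun x : ℝ => a / (x : ℂ) - 1 / 2) (-(a / x ^ 2)) x := by
    have := (((hasDerivAt_inv hx0).const_mul a).sub_const (1 / 2)).comp_ofReal
    simp only [div_eq_mul_inv a]
    exact this.congr_deriv (by ring)
  refine ((hasDerivAt_exp_mul_cpow a hx).mul
    ((hasDerivAt_laplaceUnit (intervalIntegrable_id_mul hw) x).add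
      (h2.mul (hasDerivAt_laplaceUnit hw x)))).congr_deriv ?_
  have hk : laplaceUnit (fun u => (u : ℂ) * ((u : ℂ) * betaWeight a u)) x =
      ((x - 2 * a) * laplaceUnit (fun u => (u : ℂ) * betaWeight a u) x
        + a * laplaceUnit (betaWeight a) x) / x := by
    rw [eq_div_iff hx0, mul_comm, laplaceUnit_betaWeight_kummer ha]
  simp only [Pi.add_apply, Pi.mul_apply, hk, whittP]
  field_simp
  ring

theorem tendsto_exp_mul_whittP {a : ℂ} (ha : 0 < a.re) (ha1 : a.re < 1) :
    Filter.Tendsto (fun x : ℝ => (Real.exp (-x / 2) : ℂ) * whittP a x)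
      Filter.atTop (nhds (Complex.Gamma a)) := by
  refine (tendsto_cpow_mul_laplaceUnit_neg ha ha1).congr fun x => ?_
  have : Real.exp (-x) = Real.exp (-x / 2) * Real.exp (-x / 2) := by
    rw [← Real.exp_add]; ring_nf
  rw [laplaceUnit_betaWeight_neg, whittP, this]
  push_cast
  ring

theorem norm_whittP_le {a : ℂ} (ha : 0 < a.re) (X : ℝ) : ∃ C : ℝ, 0 ≤ C ∧ ∀ x : ℝ, 0 < x → x ≤ X →
    ‖whittP a x‖ ≤ C * x ^ a.re ∧ ‖whittP' a x‖ ≤ C * x ^ (a.re - 1) := by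
  have hw := intervalIntegrable_betaWeight ha
  set I0 := ∫ u in (0 : ℝ)..1, ‖betaWeight a u‖ with hI0
  set I1 := ∫ u in (0 : ℝ)..1, ‖(u : ℂ) * betaWeight a u‖ with hI1
  have hI0' : 0 ≤ I0 := intervalIntegral.integral_nonneg zero_le_one fun _ _ => norm_nonneg _
  have hI1' : 0 ≤ I1 := intervalIntegral.integral_nonneg zero_le_one fun _ _ => norm_nonneg _
  have hE : ∀ x : ℝ, 0 < x → ‖(Real.exp (-x / 2) : ℂ) * (x : ℂ) ^ a‖ ≤ x ^ a.re := by
    intro x hx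
    rw [norm_mul, Complex.norm_real, Real.norm_of_nonneg (Real.exp_pos _).le,
      Complex.norm_cpow_eq_rpow_re_of_pos hx]
    exact mul_le_of_le_one_left (by positivity) (Real.exp_le_one_iff.2 (by linarith))
  refine ⟨Real.exp |X| * I0 + Real.exp |X| * (I1 * |X| + (‖a‖ + |X|) * I0), by positivity,
    fun x hx hxX => ?_⟩
  have hxX' : x ≤ |X| := hxX.trans (le_abs_self X)
  have hexp : Real.exp x ≤ Real.exp |X| := Real.exp_le_exp.2 hxX'
  have hJ0 : ‖laplaceUnit (betaWeight a) x‖ ≤ Real.exp |X| * I0 :=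
    (norm_laplaceUnit_le hw hx.le).trans (by gcongr)
  have hJ1 : ‖laplaceUnit (fun u => (u : ℂ) * betaWeight a u) x‖ ≤ Real.exp |X| * I1 :=
    (norm_laplaceUnit_le (intervalIntegrable_id_mul hw) hx.le).trans (by gcongr)
  constructor
  · rw [whittP, norm_mul, mul_comm]
    have h0 : 0 ≤ Real.exp |X| * (I1 * |X| + (‖a‖ + |X|) * I0) := by positivity
    have := hE x hx
    gcongr
    linarith
  · have hx0 : (x : ℂ) ≠ 0 := by exact_mod_cast hx.ne'
    have e : whittP' a x = ((Real.exp (-x / 2) : ℂ) * (x : ℂ) ^ a) *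
        ((x * laplaceUnit (fun u => (u : ℂ) * betaWeight a u) x
          + (a - x / 2) * laplaceUnit (betaWeight a) x) / x) := by
      rw [whittP']; field_simp
    rw [e, norm_mul, norm_div, Complex.norm_real, Real.norm_of_nonneg hx.le,
      Real.rpow_sub_one hx.ne', mul_div_assoc', mul_div_assoc', mul_comm]
    have h1 : ‖a - x / 2‖ ≤ ‖a‖ + |X| := by
      refine (norm_sub_le _ _).trans ?_
      have : ‖(x : ℂ) / 2‖ = x / 2 := by
        simp [abs_of_pos hx]
      rw [this]; linarith
    have h2 : ‖x * laplaceUnit (fun u => (u : ℂ) * betaWeight a u) x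
          + (a - x / 2) * laplaceUnit (betaWeight a) x‖ ≤
        Real.exp |X| * (I1 * |X| + (‖a‖ + |X|) * I0) := by
      refine (norm_add_le _ _).trans ?_
      rw [norm_mul, norm_mul, Complex.norm_real, Real.norm_of_nonneg hx.le]
      calc _ ≤ |X| * (Real.exp |X| * I1) + (‖a‖ + |X|) * (Real.exp |X| * I0) := by gcongr
        _ = _ := by ring
    have h3 : 0 ≤ Real.exp |X| * I0 := by positivity
    have := hE x hx
    gcongr
    linarith

theorem gam_sq (β : ℝ) : gam β ^ 2 = 1 / 4 - (β : ℂ) ^ 2 := by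
  have := Complex.cpow_nat_inv_pow ((1 / 4 - β ^ 2 : ℝ) : ℂ) (n := 2) (by norm_num)
  rw [Nat.cast_ofNat] at this
  rw [gam, one_div (2 : ℂ), this]
  push_cast
  rfl

theorem gam_re_nonneg (β : ℝ) : 0 ≤ (gam β).re := by
  rw [gam]
  by_cases h : ((1 / 4 - β ^ 2 : ℝ) : ℂ) = 0
  · rw [h, Complex.zero_cpow (by norm_num)]; simp
  rw [Complex.cpow_def_of_ne_zero h, Complex.exp_re]
  refine mul_nonneg (Real.exp_pos _).le (Real.cos_nonneg_of_mem_Icc ?_)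
  have e : (Complex.log ((1 / 4 - β ^ 2 : ℝ) : ℂ) * (1 / 2)).im
      = Complex.arg ((1 / 4 - β ^ 2 : ℝ) : ℂ) / 2 := by
    rw [show (1 / 2 : ℂ) = ((1 / 2 : ℝ) : ℂ) by push_cast; rfl, Complex.im_mul_ofReal,
      Complex.log_im]
    ring
  rw [e]
  have h1 := Complex.arg_le_pi ((1 / 4 - β ^ 2 : ℝ) : ℂ)
  have h2 := Complex.neg_pi_lt_arg ((1 / 4 - β ^ 2 : ℝ) : ℂ)
  constructor <;> linarith

theorem gam_re_lt {β : ℝ} (hβ : 0 < β) : (gam β).re < 1 / 2 := by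
  have h := gam_sq β
  have hre := congrArg Complex.re h
  have him := congrArg Complex.im h
  rw [← Complex.ofReal_pow] at hre him
  simp [pow_two] at hre him
  have h0 := gam_re_nonneg β
  have : (gam β).re * (gam β).im = 0 := by linarith
  rcases mul_eq_zero.1 this with h | h
  · rw [h]; norm_num
  · rw [h] at hre
    nlinarith [mul_pos hβ hβ]

/-- Kummer's function expressed through its Euler integral. -/
theorem whittM_eq {γ : ℂ} (h : 0 < (1 / 2 + γ).re) (x : ℝ) :
    whittM γ x = Complex.Gamma (1 + 2 * γ) / Complex.Gamma (1 / 2 + γ) ^ 2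
      * whittP (1 / 2 + γ) x := by
  have hΓ := Complex.Gamma_ne_zero_of_re_pos h
  have hB := Complex.Gamma_mul_Gamma_eq_betaIntegral h h
  have h2 : (1 / 2 + γ + (1 / 2 + γ)) = 1 + 2 * γ := by ring
  rw [h2] at hB
  have hM := betaIntegral_mul_chgM h x
  rw [show 2 * (1 / 2 + γ) = 1 + 2 * γ by ring] at hM
  rw [whittP, ← hM, whittM]
  push_cast
  generalize (1 / 2 : ℂ) + γ = a at *
  field_simp
  linear_combination (x : ℂ) ^ a * chgM a (1 + 2 * γ) x * hB

theorem whittW_eq {γ : ℂ} (h₁ : 0 < (1 / 2 + γ).re) (h₂ : 0 < (1 / 2 - γ).re) :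
    ∃ c : ℂ, ∀ x : ℝ, whittW γ x = c * (whittP (1 / 2 + γ) x / Complex.Gamma (1 / 2 + γ)
      - whittP (1 / 2 - γ) x / Complex.Gamma (1 / 2 - γ)) := by
  have hΓ₁ := Complex.Gamma_ne_zero_of_re_pos h₁
  have hΓ₂ := Complex.Gamma_ne_zero_of_re_pos h₂
  have r₁ := Complex.Gamma_mul_Gamma_one_sub (-(2 * γ))
  have r₂ := Complex.Gamma_mul_Gamma_one_sub (2 * γ)
  rw [sub_neg_eq_add, mul_neg, Complex.sin_neg, div_neg, ← r₂] at r₁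
  refine ⟨Complex.Gamma (-(2 * γ)) * Complex.Gamma (1 + 2 * γ)
    / (Complex.Gamma (1 / 2 + γ) * Complex.Gamma (1 / 2 - γ)), fun x => ?_⟩
  have e₂ := whittM_eq (γ := -γ) (by simpa [sub_eq_add_neg] using h₂) x
  rw [mul_neg, ← sub_eq_add_neg, ← sub_eq_add_neg] at e₂
  rw [whittW, whittM_eq h₁, e₂]
  have : Complex.Gamma (2 * γ) * Complex.Gamma (1 - 2 * γ)
    = - (Complex.Gamma (-(2 * γ)) * Complex.Gamma (1 + 2 * γ)) := by rw [r₁, neg_neg]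
  generalize (1 / 2 : ℂ) + γ = a at *
  generalize (1 / 2 : ℂ) - γ = b at *
  field_simp
  linear_combination (whittP b x * Complex.Gamma a) * this

theorem rpow_le_mul_exp {x s : ℝ} (hx : 1 ≤ x) (hs : s ≤ 1) : x ^ s ≤ 8 * Real.exp (x / 8) := by
  calc x ^ s ≤ x ^ (1 : ℝ) := Real.rpow_le_rpow_of_exponent_le hx hs
    _ = x := Real.rpow_one x
    _ ≤ 8 * Real.exp (x / 8) := by linarith [Real.add_one_le_exp (x / 8)]

/-- Bounds for a function with power growth near zero and exponential decay at infinity. -/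
theorem norm_le_rpow_mul_exp {f : ℝ → ℂ} {s A B X : ℝ} (hs1 : -1 ≤ s) (hX : 1 ≤ X)
    (hA : 0 ≤ A) (hB : 0 ≤ B)
    (h0 : ∀ x, 0 < x → x ≤ X → ‖f x‖ ≤ A * x ^ s)
    (h1 : ∀ x, X ≤ x → ‖f x‖ ≤ B * Real.exp (-x / 4)) :
    ∀ x, 0 < x → ‖f x‖ ≤ (A * Real.exp (X / 8) + 8 * B) * (x ^ s * Real.exp (-x / 8)) := by
  intro x hx
  have hxs := Real.rpow_pos_of_pos hx s
  rcases le_total x X with h | h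
  · have : 1 ≤ Real.exp (X / 8) * Real.exp (-x / 8) := by
      rw [← Real.exp_add]; exact Real.one_le_exp (by linarith)
    calc ‖f x‖ ≤ A * x ^ s := h0 x hx h
      _ ≤ A * x ^ s * (Real.exp (X / 8) * Real.exp (-x / 8)) :=
        le_mul_of_one_le_right (by positivity) this
      _ ≤ A * x ^ s * (Real.exp (X / 8) * Real.exp (-x / 8))
          + 8 * B * (x ^ s * Real.exp (-x / 8)) := by
        have : 0 ≤ 8 * B * (x ^ s * Real.exp (-x / 8)) := by positivity
        linarith
      _ = _ := by ring
  · have h8 := rpow_le_mul_exp (s := -s) (hX.trans h) (by linarith)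
    have h9 : x ^ s * x ^ (-s) = 1 := by rw [← Real.rpow_add hx]; simp
    calc ‖f x‖ ≤ B * Real.exp (-x / 4) := h1 x h
      _ = B * Real.exp (-x / 4) * (x ^ s * x ^ (-s)) := by rw [h9, mul_one]
      _ ≤ B * Real.exp (-x / 4) * (x ^ s * (8 * Real.exp (x / 8))) := by gcongr
      _ = 8 * B * (x ^ s * (Real.exp (-x / 4) * Real.exp (x / 8))) := by ring
      _ = 8 * B * (x ^ s * Real.exp (-x / 8)) := by
        rw [← Real.exp_add]; ring_nf
      _ ≤ _ := by
        have : 0 ≤ A * Real.exp (X / 8) * (x ^ s * Real.exp (-x / 8)) := by positivity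
        linarith

/-- The Whittaker function `W_{0,γ}` on the half line: regularity, behaviour at zero and
exponential decay at infinity. -/
theorem exists_whittW_bound {β : ℝ} (hβ : 0 < β) : ∃ (W' : ℝ → ℂ) (C : ℝ), 0 ≤ C ∧
    (∀ x : ℝ, 0 < x → HasDerivAt (fun x : ℝ => whittW (gam β) x) (W' x) x) ∧
    ContinuousOn W' (Ioi 0) ∧
    (∀ x : ℝ, 0 < x → ‖whittW (gam β) x‖ ≤
      C * (x ^ (1 / 2 - (gam β).re) * Real.exp (-x / 8))) ∧
    (∀ x : ℝ, 0 < x → ‖W' x‖ ≤ C * (x ^ (-1 / 2 - (gam β).re) * Real.exp (-x / 8))) := by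
  set γ := gam β with hγ
  have hμ0 : 0 ≤ γ.re := gam_re_nonneg β
  have hμ1 : γ.re < 1 / 2 := gam_re_lt hβ
  have re₁ : (1 / 2 + γ).re = 1 / 2 + γ.re := by simp
  have re₂ : (1 / 2 - γ).re = 1 / 2 - γ.re := by simp
  have h₁ : 0 < (1 / 2 + γ).re := by rw [re₁]; linarith
  have h₂ : 0 < (1 / 2 - γ).re := by rw [re₂]; linarith
  have hΓ₁ := Complex.Gamma_ne_zero_of_re_pos h₁
  have hΓ₂ := Complex.Gamma_ne_zero_of_re_pos h₂
  obtain ⟨c, hc⟩ := whittW_eq h₁ h₂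
  set W' : ℝ → ℂ := fun x => c * (whittP' (1 / 2 + γ) x / Complex.Gamma (1 / 2 + γ)
      - whittP' (1 / 2 - γ) x / Complex.Gamma (1 / 2 - γ)) with hW'
  have hd : ∀ x : ℝ, 0 < x → HasDerivAt (fun x : ℝ => whittW γ x) (W' x) x := by
    intro x hx
    simp only [hc]
    exact (((hasDerivAt_whittP h₁ hx).div_const _).sub
      ((hasDerivAt_whittP h₂ hx).div_const _)).const_mul c
  have hd' : ∀ x : ℝ, 0 < x →
      HasDerivAt W' (((1 / 4 - β ^ 2 / x ^ 2 : ℝ) : ℂ) * whittW γ x) x := by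
    intro x hx
    rw [hc]
    refine ((((hasDerivAt_whittP' h₁ hx).div_const _).sub
      ((hasDerivAt_whittP' h₂ hx).div_const _)).const_mul c).congr_deriv ?_
    have hγ2 := gam_sq β
    rw [← hγ] at hγ2
    have e₁ : (1 / 2 + γ) * (1 - (1 / 2 + γ)) = (β : ℂ) ^ 2 := by linear_combination -hγ2
    have e₂ : (1 / 2 - γ) * (1 - (1 / 2 - γ)) = (β : ℂ) ^ 2 := by linear_combination -hγ2
    rw [e₁, e₂]
    push_cast
    ring
  have hlim : Filter.Tendsto (fun x : ℝ => Real.exp (-x / 2) * ‖whittW γ x‖)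
      Filter.atTop (nhds 0) := by
    have := (((tendsto_exp_mul_whittP h₁ (by rw [re₁]; linarith)).div_const
      (Complex.Gamma (1 / 2 + γ))).sub ((tendsto_exp_mul_whittP h₂
        (by rw [re₂]; linarith)).div_const (Complex.Gamma (1 / 2 - γ)))).const_mul c
    rw [div_self hΓ₁, div_self hΓ₂, sub_self, mul_zero] at this
    refine (tendsto_norm_zero.comp this).congr fun x => ?_
    have hn : Real.exp (-x / 2) = ‖(Real.exp (-x / 2) : ℂ)‖ := by
      rw [Complex.norm_real, Real.norm_of_nonneg (Real.exp_pos _).le]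
    rw [hn, ← norm_mul, hc, Function.comp]
    congr 1
    ring
  obtain ⟨A, X, hA, hX, hAX⟩ := exp_decay_of_isLittleO (b := β ^ 2) (by positivity) hd hd' hlim
  obtain ⟨C₁, hC₁, hb₁⟩ := norm_whittP_le h₁ X
  obtain ⟨C₂, hC₂, hb₂⟩ := norm_whittP_le h₂ X
  have hpow : ∀ x : ℝ, 0 < x → x ≤ X → ∀ s : ℝ,
      x ^ ((1 / 2 + γ).re + s) ≤ X * x ^ ((1 / 2 - γ).re + s) := by
    intro x hx hxX s
    have : x ^ ((1 / 2 + γ).re + s) = x ^ (2 * γ.re) * x ^ ((1 / 2 - γ).re + s) := by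
      rw [← Real.rpow_add hx, re₁, re₂]; ring_nf
    rw [this]
    gcongr
    calc x ^ (2 * γ.re) ≤ X ^ (2 * γ.re) := by gcongr
      _ ≤ X ^ (1 : ℝ) := Real.rpow_le_rpow_of_exponent_le hX (by linarith)
      _ = X := Real.rpow_one X
  set D := ‖c‖ * (C₁ * X / ‖Complex.Gamma (1 / 2 + γ)‖ + C₂ / ‖Complex.Gamma (1 / 2 - γ)‖) with hD
  have hcomb : ∀ (p q : ℂ) (P Q : ℝ), ‖p‖ ≤ C₁ * P → ‖q‖ ≤ C₂ * Q → P ≤ X * Q →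
      ‖c * (p / Complex.Gamma (1 / 2 + γ) - q / Complex.Gamma (1 / 2 - γ))‖ ≤ D * Q := by
    intro p q P Q hp hq hPQ
    have hp' : ‖p‖ ≤ C₁ * (X * Q) := hp.trans (by gcongr)
    rw [norm_mul]
    calc _ ≤ ‖c‖ * (‖p‖ / ‖Complex.Gamma (1 / 2 + γ)‖ + ‖q‖ / ‖Complex.Gamma (1 / 2 - γ)‖) := by
          gcongr
          exact (norm_sub_le _ _).trans (by rw [norm_div, norm_div])
      _ ≤ ‖c‖ * ((C₁ * (X * Q)) / ‖Complex.Gamma (1 / 2 + γ)‖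
          + (C₂ * Q) / ‖Complex.Gamma (1 / 2 - γ)‖) := by gcongr
      _ = _ := by rw [hD]; ring
  have hX0 : 0 ≤ X := by linarith
  have hD0 : 0 ≤ D := by positivity
  refine ⟨W', D * Real.exp (X / 8) + 8 * A, by positivity, hd,
    fun x hx => (hd' x hx).continuousAt.continuousWithinAt, ?_, ?_⟩
  · refine norm_le_rpow_mul_exp (by linarith) hX hD0 hA (fun x hx hxX => ?_)
      fun x hx => (hAX x hx).1
    rw [hc]
    refine hcomb _ _ _ _ (hb₁ x hx hxX).1 ((hb₂ x hx hxX).1.trans (by rw [re₂])) ?_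
    have := hpow x hx hxX 0
    rwa [add_zero, add_zero, re₂] at this
  · refine norm_le_rpow_mul_exp (by linarith) hX hD0 hA (fun x hx hxX => ?_)
      fun x hx => (hAX x hx).2
    have e : (1 / 2 - γ).re - 1 = -1 / 2 - γ.re := by rw [re₂]; ring
    refine hcomb _ _ _ _ (hb₁ x hx hxX).2 ((hb₂ x hx hxX).2.trans (by rw [e])) ?_
    have := hpow x hx hxX (-1)
    rwa [← sub_eq_add_neg, ← sub_eq_add_neg, e] at this

/-- A bounded `C¹` function `G` with bounded derivative `G'`. -/
structure BoundedC1 (G G' : ℝ → ℂ) : Prop where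
  hasDerivAt : ∀ y, HasDerivAt G (G' y) y
  continuous_deriv : Continuous G'
  bounded : ∃ K, ∀ y, ‖G y‖ ≤ K ∧ ‖G' y‖ ≤ K

theorem BoundedC1.continuous {G G' : ℝ → ℂ} (h : BoundedC1 G G') : Continuous G :=
  continuous_iff_continuousAt.2 fun y => (h.hasDerivAt y).continuousAt

theorem BoundedC1.add {G G' H H' : ℝ → ℂ} (h : BoundedC1 G G') (k : BoundedC1 H H') :
    BoundedC1 (fun y => G y + H y) fun y => G' y + H' y := by
  obtain ⟨K, hK⟩ := h.bounded
  obtain ⟨L, hL⟩ := k.bounded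
  exact ⟨fun y => (h.hasDerivAt y).add (k.hasDerivAt y), h.continuous_deriv.add k.continuous_deriv,
    K + L, fun y => ⟨norm_add_le_of_le (hK y).1 (hL y).1, norm_add_le_of_le (hK y).2 (hL y).2⟩⟩

theorem BoundedC1.const_mul {G G' : ℝ → ℂ} (h : BoundedC1 G G') (c : ℂ) :
    BoundedC1 (fun y => c * G y) fun y => c * G' y := by
  obtain ⟨K, hK⟩ := h.bounded
  refine ⟨fun y => (h.hasDerivAt y).const_mul c, continuous_const.mul h.continuous_deriv,
    ‖c‖ * K, fun y => ?_⟩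
  rw [norm_mul, norm_mul]
  exact ⟨mul_le_mul_of_nonneg_left (hK y).1 (norm_nonneg _),
    mul_le_mul_of_nonneg_left (hK y).2 (norm_nonneg _)⟩

theorem BoundedC1.comp_neg {G G' : ℝ → ℂ} (h : BoundedC1 G G') :
    BoundedC1 (fun y => G (-y)) fun y => -G' (-y) := by
  obtain ⟨K, hK⟩ := h.bounded
  refine ⟨fun y => ?_, (h.continuous_deriv.comp continuous_neg).neg, K, fun y => ?_⟩
  · have := (h.hasDerivAt (-y)).scomp y (hasDerivAt_neg y)
    exact this.congr_deriv (by simp)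
  · rw [norm_neg]; exact hK (-y)

theorem BoundedC1.of_compactSupport {G : ℝ → ℂ} (h : ContDiff ℝ 1 G) (hs : HasCompactSupport G) :
    BoundedC1 G (deriv G) := by
  have hc' : Continuous (deriv G) := h.continuous_deriv le_rfl
  obtain ⟨K, hK⟩ := hs.exists_bound_of_continuous h.continuous
  obtain ⟨L, hL⟩ := hs.deriv.exists_bound_of_continuous hc'
  exact ⟨fun y => (h.differentiable one_ne_zero y).hasDerivAt, hc', max K L,
    fun y => ⟨(hK y).trans (le_max_left _ _), (hL y).trans (le_max_right _ _)⟩⟩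

/-- Superposition of translates of `G` with weight `κ`. -/
def translateIntegral (ν : Measure ℝ) (κ : ℝ → ℂ) (c : ℝ) (G : ℝ → ℂ) (y : ℝ) : ℂ :=
  ∫ x, κ x * G (y + c * x) ∂ν

theorem integrable_mul_translate {ν : Measure ℝ} {κ : ℝ → ℂ} (hκ : Integrable κ ν) (c : ℝ)
    {G : ℝ → ℂ} (hG : Continuous G) {K : ℝ} (hK : ∀ y, ‖G y‖ ≤ K) (y : ℝ) :
    Integrable (fun x => κ x * G (y + c * x)) ν :=
  hκ.mul_bdd (c := K) (hG.comp (by fun_prop)).aestronglyMeasurable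
    (Filter.Eventually.of_forall fun _ => hK _)

theorem continuous_translateIntegral {ν : Measure ℝ} {κ : ℝ → ℂ} (hκ : Integrable κ ν) (c : ℝ)
    {G : ℝ → ℂ} (hG : Continuous G) {K : ℝ} (hK : ∀ y, ‖G y‖ ≤ K) :
    Continuous (translateIntegral ν κ c G) := by
  refine continuous_of_dominated (bound := fun x => ‖κ x‖ * K)
    (fun y => (integrable_mul_translate hκ c hG hK y).aestronglyMeasurable)
    (fun y => Filter.Eventually.of_forall fun x => ?_) (hκ.norm.mul_const K)
    (Filter.Eventually.of_forall fun x => ?_)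
  · rw [norm_mul]; exact mul_le_mul_of_nonneg_left (hK _) (norm_nonneg _)
  · exact continuous_const.mul (hG.comp (by fun_prop))

theorem norm_translateIntegral_le {ν : Measure ℝ} {κ : ℝ → ℂ} (hκ : Integrable κ ν) (c : ℝ)
    {G : ℝ → ℂ} {K : ℝ} (hK : ∀ y, ‖G y‖ ≤ K) (y : ℝ) :
    ‖translateIntegral ν κ c G y‖ ≤ (∫ x, ‖κ x‖ ∂ν) * K := by
  rw [translateIntegral, ← integral_mul_const]
  refine norm_integral_le_of_norm_le (hκ.norm.mul_const K)
    (Filter.Eventually.of_forall fun x => ?_)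
  rw [norm_mul]
  exact mul_le_mul_of_nonneg_left (hK _) (norm_nonneg _)

theorem BoundedC1.translateIntegral {ν : Measure ℝ} {κ : ℝ → ℂ} (hκ : Integrable κ ν) (c : ℝ)
    {G G' : ℝ → ℂ} (h : BoundedC1 G G') :
    BoundedC1 (translateIntegral ν κ c G) (translateIntegral ν κ c G') := by
  obtain ⟨K, hK⟩ := h.bounded
  refine ⟨fun y => ?_, continuous_translateIntegral hκ c h.continuous_deriv fun y => (hK y).2,
    (∫ x, ‖κ x‖ ∂ν) * K, fun y => ⟨norm_translateIntegral_le hκ c (fun y => (hK y).1) y,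
      norm_translateIntegral_le hκ c (fun y => (hK y).2) y⟩⟩
  refine (hasDerivAt_integral_of_dominated_loc_of_deriv_le
    (F := fun y x => κ x * G (y + c * x)) (F' := fun y x => κ x * G' (y + c * x))
    (bound := fun x => ‖κ x‖ * K) Filter.univ_mem
    (Filter.Eventually.of_forall fun y =>
      (integrable_mul_translate hκ c h.continuous (fun y => (hK y).1) y).aestronglyMeasurable)
    (integrable_mul_translate hκ c h.continuous (fun y => (hK y).1) y)
    (integrable_mul_translate hκ c h.continuous_deriv (fun y => (hK y).2) y).aestronglyMeasurable
    (Filter.Eventually.of_forall fun x y _ => ?_) (hκ.norm.mul_const K)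
    (Filter.Eventually.of_forall fun x y _ => ?_)).2
  · rw [norm_mul]; exact mul_le_mul_of_nonneg_left (hK _).2 (norm_nonneg _)
  · exact ((h.hasDerivAt _).comp_add_const y (c * x)).const_mul _

theorem sq_lintegral_mul_le {ν : Measure ℝ} {k g : ℝ → ℝ≥0∞} (hk : AEMeasurable k ν)
    (hg : AEMeasurable g ν) :
    (∫⁻ x, k x * g x ∂ν) ^ 2 ≤ (∫⁻ x, k x ∂ν) * ∫⁻ x, k x * g x ^ 2 ∂ν := by
  have h := ENNReal.lintegral_mul_norm_pow_le (p := 1 / 2) (q := 1 / 2) hk (hk.mul (hg.pow_const 2))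
    (by norm_num) (by norm_num) (by norm_num)
  have e : ∀ x, k x ^ (1 / 2 : ℝ) * ((k * fun x => g x ^ 2) x) ^ (1 / 2 : ℝ) = k x * g x := by
    intro x
    rw [← ENNReal.mul_rpow_of_nonneg _ _ (by norm_num), Pi.mul_apply, ← mul_assoc, ← pow_two,
      ← mul_pow, ← ENNReal.rpow_natCast, ← ENNReal.rpow_mul]
    norm_num
  simp only [e] at h
  calc _ ≤ ((∫⁻ x, k x ∂ν) ^ (1 / 2 : ℝ)
        * (∫⁻ x, (k * fun x => g x ^ 2) x ∂ν) ^ (1 / 2 : ℝ)) ^ 2 := by gcongr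
    _ = _ := by
      rw [← ENNReal.mul_rpow_of_nonneg _ _ (by norm_num), ← ENNReal.rpow_natCast,
        ← ENNReal.rpow_mul]
      norm_num

theorem eLpNorm_two_sq (f : ℝ → ℂ) :
    eLpNorm f 2 (volume : Measure ℝ) ^ 2 = ∫⁻ y, ‖f y‖ₑ ^ 2 := by
  rw [eLpNorm_eq_lintegral_rpow_enorm_toReal two_ne_zero ENNReal.ofNat_ne_top,
    ← ENNReal.rpow_natCast, ← ENNReal.rpow_mul]
  norm_num

/-- Minkowski's inequality for a superposition of translates. -/
theorem eLpNorm_translateIntegral_le {ν : Measure ℝ} [SFinite ν] {κ : ℝ → ℂ}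
    (hκ : AEStronglyMeasurable κ ν) (c : ℝ) {G : ℝ → ℂ} (hG : Continuous G) :
    eLpNorm (translateIntegral ν κ c G) 2 volume ≤ (∫⁻ x, ‖κ x‖ₑ ∂ν) * eLpNorm G 2 volume := by
  rw [← ENNReal.pow_le_pow_left_iff two_ne_zero, mul_pow, eLpNorm_two_sq, eLpNorm_two_sq]
  have hG2 : Measurable fun p : ℝ × ℝ => ‖G (p.1 + c * p.2)‖ₑ :=
    (hG.comp (by fun_prop)).enorm.measurable
  calc ∫⁻ y, ‖translateIntegral ν κ c G y‖ₑ ^ 2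
      ≤ ∫⁻ y, (∫⁻ x, ‖κ x‖ₑ ∂ν) * ∫⁻ x, ‖κ x‖ₑ * ‖G (y + c * x)‖ₑ ^ 2 ∂ν := by
        refine lintegral_mono fun y => ?_
        refine le_trans ?_ (sq_lintegral_mul_le hκ.enorm
          (g := fun x => ‖G (y + c * x)‖ₑ) (hG.comp (by fun_prop)).enorm.measurable.aemeasurable)
        gcongr
        refine (enorm_integral_le_lintegral_enorm _).trans_eq ?_
        simp only [enorm_mul]
    _ ≤ (∫⁻ x, ‖κ x‖ₑ ∂ν) * ∫⁻ y, ∫⁻ x, ‖κ x‖ₑ * ‖G (y + c * x)‖ₑ ^ 2 ∂ν := by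
        refine (lintegral_const_mul'' _ ?_).le
        exact ((hκ.enorm.comp_snd (μ := (volume : Measure ℝ))).mul
          (hG2.pow_const 2).aemeasurable).lintegral_prod_right'
    _ = (∫⁻ x, ‖κ x‖ₑ ∂ν) * ∫⁻ x, (∫⁻ y, ‖κ x‖ₑ * ‖G (y + c * x)‖ₑ ^ 2) ∂ν := by
        congr 1
        exact lintegral_lintegral_swap <| (hκ.enorm.comp_snd (μ := (volume : Measure ℝ))).mul (hG2.pow_const 2).aemeasurable
    _ = (∫⁻ x, ‖κ x‖ₑ ∂ν) * ∫⁻ x, ‖κ x‖ₑ * (∫⁻ y, ‖G y‖ₑ ^ 2) ∂ν := by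
        congr 1
        refine lintegral_congr fun x => ?_
        have hm : Measurable fun y => ‖G (y + c * x)‖ₑ ^ 2 :=
          ((hG.comp (by fun_prop)).enorm.measurable.pow_const 2)
        rw [lintegral_const_mul _ hm, lintegral_add_right_eq_self (fun y => ‖G y‖ₑ ^ 2)]
    _ = _ := by
        rw [lintegral_mul_const'' _ hκ.enorm, pow_two, mul_assoc]

theorem integrableOn_of_norm_le_rpow_mul_exp {f : ℝ → ℂ} {s B : ℝ} (hf : ContinuousOn f (Ioi 0))
    (hs : -1 < s) (h : ∀ x, 0 < x → ‖f x‖ ≤ B * (x ^ s * Real.exp (-x / 8))) :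
    IntegrableOn f (Ioi 0) := by
  have hi := (integrableOn_rpow_mul_exp_neg_mul_rpow hs one_pos
    (show (0 : ℝ) < 1 / 8 by norm_num)).const_mul B
  refine Integrable.mono' hi (hf.aestronglyMeasurable measurableSet_Ioi) ?_
  filter_upwards [ae_restrict_mem measurableSet_Ioi] with x hx
  refine (h x hx).trans_eq ?_
  rw [Real.rpow_one]
  ring_nf

/-- A `C¹` function on the half line with an integrable power singularity at zero and
exponential decay. -/
structure OscWeight (μ C : ℝ) (q q' : ℝ → ℂ) : Prop where
  nonneg : 0 ≤ μ
  lt_half : μ < 1 / 2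
  const_nonneg : 0 ≤ C
  hasDerivAt : ∀ x, 0 < x → HasDerivAt q (q' x) x
  continuousOn_deriv : ContinuousOn q' (Ioi 0)
  norm_le : ∀ x, 0 < x → ‖q x‖ ≤ C * (x ^ (-1 / 2 - μ) * Real.exp (-x / 8))
  norm_deriv_le : ∀ x, 0 < x → ‖q' x‖ ≤ C * x ^ (-3 / 2 - μ)

section

variable {μ C : ℝ} {q q' : ℝ → ℂ}

theorem OscWeight.continuousOn (h : OscWeight μ C q q') : ContinuousOn q (Ioi 0) :=
  fun x hx => (h.hasDerivAt x hx).continuousAt.continuousWithinAt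

theorem OscWeight.norm_le_rpow (h : OscWeight μ C q q') {x : ℝ} (hx : 0 < x) :
    ‖q x‖ ≤ C * x ^ (-1 / 2 - μ) := by
  have := h.const_nonneg
  refine (h.norm_le x hx).trans ?_
  gcongr
  exact mul_le_of_le_one_right (Real.rpow_nonneg hx.le _) (Real.exp_le_one_iff.2 (by linarith))

theorem OscWeight.integrableOn (h : OscWeight μ C q q') : IntegrableOn q (Ioi 0) :=
  integrableOn_of_norm_le_rpow_mul_exp h.continuousOn (by linarith [h.lt_half]) h.norm_le

theorem OscWeight.integrableOn_deriv (h : OscWeight μ C q q') {δ : ℝ} (hδ : 0 < δ) :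
    IntegrableOn q' (Ioi δ) := by
  have hi : IntegrableOn (fun x : ℝ => x ^ (-3 / 2 - μ)) (Ioi δ) :=
    integrableOn_Ioi_rpow_of_lt (by linarith [h.nonneg]) hδ
  refine Integrable.mono' (hi.const_mul C)
    ((h.continuousOn_deriv.mono (Ioi_subset_Ioi hδ.le)).aestronglyMeasurable measurableSet_Ioi) ?_
  filter_upwards [ae_restrict_mem measurableSet_Ioi] with x hx
  exact h.norm_deriv_le x (hδ.trans hx)

theorem lintegral_enorm_le_ofReal {ν : Measure ℝ} {f : ℝ → ℂ} {g : ℝ → ℝ} (hg : Integrable g ν)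
    (h : ∀ᵐ x ∂ν, ‖f x‖ ≤ g x) : ∫⁻ x, ‖f x‖ₑ ∂ν ≤ ENNReal.ofReal (∫ x, g x ∂ν) := by
  rw [ofReal_integral_eq_lintegral_ofReal hg (h.mono fun x hx => (norm_nonneg _).trans hx)]
  refine lintegral_mono_ae (h.mono fun x hx => ?_)
  rw [← ofReal_norm]
  exact ENNReal.ofReal_le_ofReal hx

theorem OscWeight.lintegral_Ioc_le (h : OscWeight μ C q q') {δ : ℝ} (hδ : 0 < δ) :
    ∫⁻ x in Ioc 0 δ, ‖q x‖ₑ ≤ ENNReal.ofReal (C / (1 / 2 - μ) * δ ^ (1 / 2 - μ)) := by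
  have hμ := h.lt_half
  have hs : -1 < -1 / 2 - μ := by linarith
  have hi : IntegrableOn (fun x : ℝ => x ^ (-1 / 2 - μ)) (Ioc 0 δ) :=
    (intervalIntegrable_iff_integrableOn_Ioc_of_le hδ.le).1
      (intervalIntegral.intervalIntegrable_rpow' hs)
  refine (lintegral_enorm_le_ofReal (hi.const_mul C) ?_).trans_eq ?_
  · filter_upwards [ae_restrict_mem measurableSet_Ioc] with x hx
    exact h.norm_le_rpow hx.1
  · rw [integral_const_mul, ← intervalIntegral.integral_of_le hδ.le, integral_rpow (Or.inl hs),
      show -1 / 2 - μ + 1 = 1 / 2 - μ by ring, Real.zero_rpow (by linarith)]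
    congr 1
    ring

theorem OscWeight.lintegral_deriv_Ioi_le (h : OscWeight μ C q q') {δ : ℝ} (hδ : 0 < δ) :
    ∫⁻ x in Ioi δ, ‖q' x‖ₑ ≤ ENNReal.ofReal (C / (1 / 2 + μ) * δ ^ (-1 / 2 - μ)) := by
  have hμ := h.nonneg
  have hs : -3 / 2 - μ < -1 := by linarith
  have hi : IntegrableOn (fun x : ℝ => x ^ (-3 / 2 - μ)) (Ioi δ) :=
    integrableOn_Ioi_rpow_of_lt hs hδ
  refine (lintegral_enorm_le_ofReal (hi.const_mul C) ?_).trans_eq ?_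
  · filter_upwards [ae_restrict_mem measurableSet_Ioi] with x hx
    exact h.norm_deriv_le x (hδ.trans hx)
  · rw [integral_const_mul, integral_Ioi_rpow_of_lt hs hδ,
      show -3 / 2 - μ + 1 = -(1 / 2 + μ) by ring, neg_div_neg_eq,
      show -(1 / 2 + μ) = -1 / 2 - μ by ring]
    congr 1
    ring

/-- Integration by parts away from the singularity of the weight. -/
theorem OscWeight.integral_exp_mul_eq (h : OscWeight μ C q q') {δ τ : ℝ} (hδ : 0 < δ)
    (hτ : τ ≠ 0) (s : ℝ) {A A' : ℝ → ℂ} (hA : BoundedC1 A A') (y : ℝ) :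
    translateIntegral (volume.restrict (Ioi 0)) (fun x : ℝ => Complex.exp (I * τ * x) * q x) (-s) A y =
      translateIntegral (volume.restrict (Ioc 0 δ))
          (fun x : ℝ => Complex.exp (I * τ * x) * q x) (-s) A y
        - (q δ * (Complex.exp (I * τ * δ) / (I * τ))) * A (y + -s * δ)
        - translateIntegral (volume.restrict (Ioi δ))
            (fun x : ℝ => Complex.exp (I * τ * x) / (I * τ) * q' x) (-s) A y
        + s * translateIntegral (volume.restrict (Ioi δ))
            (fun x : ℝ => Complex.exp (I * τ * x) / (I * τ) * q x) (-s) A' y := by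
  obtain ⟨K, hK⟩ := hA.bounded
  have hIτ : I * (τ : ℂ) ≠ 0 := mul_ne_zero I_ne_zero (by exact_mod_cast hτ)
  have hnorm : ∀ x : ℝ, ‖Complex.exp (I * τ * x)‖ = 1 := fun x => by
    rw [show I * (τ : ℂ) * x = ((τ * x : ℝ) : ℂ) * I by push_cast; ring]
    exact Complex.norm_exp_ofReal_mul_I _
  have hexpc : Continuous fun x : ℝ => Complex.exp (I * τ * x) := by fun_prop
  have hqδ : IntegrableOn q (Ioi δ) := h.integrableOn.mono_set (Ioi_subset_Ioi hδ.le)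
  have hexp : ∀ {f : ℝ → ℂ} {ν : Measure ℝ}, Integrable f ν →
      Integrable (fun x : ℝ => Complex.exp (I * τ * x) * f x) ν := fun hf =>
    hf.bdd_mul hexpc.aestronglyMeasurable (Filter.Eventually.of_forall fun x => (hnorm x).le)
  have hexp' : ∀ {f : ℝ → ℂ} {ν : Measure ℝ}, Integrable f ν →
      Integrable (fun x : ℝ => Complex.exp (I * τ * x) / (I * τ) * f x) ν := fun hf =>
    ((hexp hf).const_mul (I * τ)⁻¹).congr (Filter.Eventually.of_forall fun x => by
      simp only; ring)
  have hi0 := integrable_mul_translate (hexp h.integrableOn) (-s) hA.continuous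
    (fun y => (hK y).1) y
  have hsplit : translateIntegral (volume.restrict (Ioi 0))
      (fun x : ℝ => Complex.exp (I * τ * x) * q x) (-s) A y =
      translateIntegral (volume.restrict (Ioc 0 δ))
          (fun x : ℝ => Complex.exp (I * τ * x) * q x) (-s) A y
      + translateIntegral (volume.restrict (Ioi δ))
          (fun x : ℝ => Complex.exp (I * τ * x) * q x) (-s) A y := by
    rw [translateIntegral, translateIntegral, translateIntegral, ← Ioc_union_Ioi_eq_Ioi hδ.le]
    exact setIntegral_union (Ioc_disjoint_Ioi le_rfl) measurableSet_Ioi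
      (IntegrableOn.mono_set hi0 fun x hx => hx.1)
      (IntegrableOn.mono_set hi0 (Ioi_subset_Ioi hδ.le))
  have i1 := integrable_mul_translate (hexp' (h.integrableOn_deriv hδ)) (-s) hA.continuous
    (fun y => (hK y).1) y
  have i2 := (integrable_mul_translate (hexp' hqδ) (-s) hA.continuous_deriv
    (fun y => (hK y).2) y).const_mul (-s : ℂ)
  have hu : ∀ x, 0 < x → HasDerivAt (fun x => q x * A (y + -s * x))
      (q' x * A (y + -s * x) + q x * (-s * A' (y + -s * x))) x := by
    intro x hx
    have h1 : HasDerivAt (fun x : ℝ => y + -s * x) (-s) x := by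
      simpa using ((hasDerivAt_id x).const_mul (-s)).const_add y
    have h2 := (hA.hasDerivAt (y + -s * x)).scomp x h1
    refine ((h.hasDerivAt x hx).mul h2).congr_deriv ?_
    simp
  have hv : ∀ x : ℝ, HasDerivAt (fun x : ℝ => Complex.exp (I * τ * x) / (I * τ))
      (Complex.exp (I * τ * x)) x := by
    intro x
    have h1 : HasDerivAt (fun x : ℝ => I * τ * (x : ℂ)) (I * τ) x := by
      simpa using (hasDerivAt_id x).ofReal_comp.const_mul (I * τ)
    refine (h1.cexp.div_const _).congr_deriv ?_
    rw [mul_div_assoc, div_self hIτ, mul_one]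
  have hparts := integral_Ioi_mul_deriv_eq_deriv_mul (a := δ)
    (u := fun x => q x * A (y + -s * x))
    (u' := fun x => q' x * A (y + -s * x) + q x * (-s * A' (y + -s * x)))
    (v := fun x : ℝ => Complex.exp (I * τ * x) / (I * τ))
    (v' := fun x : ℝ => Complex.exp (I * τ * x))
    (a' := q δ * A (y + -s * δ) * (Complex.exp (I * τ * δ) / (I * τ))) (b' := 0)
    (fun x hx => hu x (hδ.trans hx)) (fun x _ => hv x)
    ((IntegrableOn.mono_set hi0 (Ioi_subset_Ioi hδ.le)).congr
      (Filter.Eventually.of_forall fun x => by simp only [Pi.mul_apply]; ring))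
    ((i1.add i2).congr (Filter.Eventually.of_forall fun x => by
      simp only [Pi.mul_apply, Pi.add_apply]; ring))
    (((hu δ hδ).mul (hv δ)).continuousAt.tendsto.mono_left nhdsWithin_le_nhds) ?_
  · rw [hsplit]
    have e1 : translateIntegral (volume.restrict (Ioi δ))
          (fun x : ℝ => Complex.exp (I * τ * x) * q x) (-s) A y
        = ∫ x in Ioi δ, q x * A (y + -s * x) * Complex.exp (I * τ * x) :=
      integral_congr_ae (Filter.Eventually.of_forall fun x => by simp only; ring)
    have e2 : ∫ x in Ioi δ, (q' x * A (y + -s * x) + q x * (-s * A' (y + -s * x)))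
          * (Complex.exp (I * τ * x) / (I * τ))
        = translateIntegral (volume.restrict (Ioi δ))
            (fun x : ℝ => Complex.exp (I * τ * x) / (I * τ) * q' x) (-s) A y
          + (-s) * translateIntegral (volume.restrict (Ioi δ))
            (fun x : ℝ => Complex.exp (I * τ * x) / (I * τ) * q x) (-s) A' y := by
      rw [translateIntegral, translateIntegral, ← integral_const_mul, ← integral_add i1 i2]
      exact integral_congr_ae (Filter.Eventually.of_forall fun x => by simp only; ring)
    rw [e1, hparts, e2]
    ring
  · refine squeeze_zero_norm' (a := fun x => C * K / |τ| * x ^ (-(1 / 2 + μ))) ?_ ?_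
    · filter_upwards [Filter.eventually_gt_atTop 0] with x hx
      have hK0 : 0 ≤ K := (norm_nonneg _).trans (hK 0).1
      have hn := h.norm_le_rpow hx
      rw [Pi.mul_apply, norm_mul, norm_mul, norm_div, hnorm, norm_mul, norm_I, one_mul,
        Complex.norm_real, Real.norm_eq_abs, show -(1 / 2 + μ) = -1 / 2 - μ by ring]
      have hC := h.const_nonneg
      have hx' := Real.rpow_nonneg hx.le (-1 / 2 - μ)
      calc ‖q x‖ * ‖A (y + -s * x)‖ * (1 / |τ|)
          ≤ (C * x ^ (-1 / 2 - μ)) * K * (1 / |τ|) := by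
            gcongr
            exact (hK _).1
        _ = _ := by ring
    · have := (tendsto_rpow_neg_atTop (show 0 < 1 / 2 + μ by linarith [h.nonneg])).const_mul
        (C * K / |τ|)
      rwa [mul_zero] at this

theorem eLpNorm_const_mul (c : ℂ) (f : ℝ → ℂ) :
    eLpNorm (fun y => c * f y) 2 (volume : Measure ℝ) = ‖c‖ₑ * eLpNorm f 2 volume :=
  eLpNorm_const_smul c f 2 volume

theorem eLpNorm_add_le_of_continuous {f g : ℝ → ℂ} (hf : Continuous f) (hg : Continuous g) :
    eLpNorm (fun y => f y + g y) 2 (volume : Measure ℝ)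
      ≤ eLpNorm f 2 volume + eLpNorm g 2 volume :=
  eLpNorm_add_le hf.aestronglyMeasurable hg.aestronglyMeasurable one_le_two

theorem eLpNorm_sub_le_of_continuous {f g : ℝ → ℂ} (hf : Continuous f) (hg : Continuous g) :
    eLpNorm (fun y => f y - g y) 2 (volume : Measure ℝ)
      ≤ eLpNorm f 2 volume + eLpNorm g 2 volume :=
  eLpNorm_sub_le hf.aestronglyMeasurable hg.aestronglyMeasurable one_le_two

/-- Decay of an oscillatory superposition of translates. -/
theorem OscWeight.exists_eLpNorm_le (h : OscWeight μ C q q') : ∃ K : ℝ, 0 ≤ K ∧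
    ∀ t τ : ℝ, 1 ≤ t → |τ| = t / 2 → ∀ s : ℝ, 0 ≤ s → ∀ A A' : ℝ → ℂ, BoundedC1 A A' →
      eLpNorm (translateIntegral (volume.restrict (Ioi 0))
          (fun x : ℝ => Complex.exp (I * τ * x) * q x) (-s) A) 2 volume ≤
        ENNReal.ofReal (K * t ^ (-1 / 2 + μ)) *
          (eLpNorm A 2 volume + ENNReal.ofReal s * eLpNorm A' 2 volume) := by
  have hμ0 := h.nonneg
  have hμ1 := h.lt_half
  have hC := h.const_nonneg
  have hμ2 : 0 < 1 / 2 - μ := by linarith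
  set K0 := ∫ x in Ioi 0, ‖q x‖ with hK0
  have hK0' : 0 ≤ K0 := integral_nonneg fun x => norm_nonneg _
  refine ⟨C / (1 / 2 - μ) + 2 * C + 2 * (C / (1 / 2 + μ)) + 2 * K0, by positivity,
    fun t τ ht hτt s hs A A' hA => ?_⟩
  obtain ⟨L, hL⟩ := hA.bounded
  have ht0 : 0 < t := by linarith
  have hδ : 0 < t⁻¹ := by positivity
  have hτ : τ ≠ 0 := by rw [← abs_pos, hτt]; positivity
  have hexpc : Continuous fun x : ℝ => Complex.exp (I * τ * x) := by fun_prop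
  have hnorm : ∀ x : ℝ, ‖Complex.exp (I * τ * x)‖ = 1 := fun x => by
    rw [show I * (τ : ℂ) * x = ((τ * x : ℝ) : ℂ) * I by push_cast; ring]
    exact Complex.norm_exp_ofReal_mul_I _
  have hnorm' : ∀ x : ℝ, ‖Complex.exp (I * τ * x) / (I * τ)‖ = 2 / t := fun x => by
    rw [norm_div, hnorm, norm_mul, norm_I, one_mul, Complex.norm_real, Real.norm_eq_abs, hτt,
      one_div_div]
  set R := t ^ (-1 / 2 + μ) with hR
  have hR0 : 0 ≤ R := Real.rpow_nonneg ht0.le _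
  have hδ1 : t⁻¹ ^ (1 / 2 - μ) = R := by
    rw [Real.inv_rpow ht0.le, ← Real.rpow_neg ht0.le, hR]; ring_nf
  have hδ2 : 2 / t * t⁻¹ ^ (-1 / 2 - μ) = 2 * R := by
    rw [Real.inv_rpow ht0.le, ← Real.rpow_neg ht0.le, hR,
      show -1 / 2 + μ = -(-1 / 2 - μ) - 1 by ring, Real.rpow_sub_one ht0.ne']
    ring
  have hδ3 : 2 / t ≤ 2 * R := by
    rw [div_eq_mul_inv, ← Real.rpow_neg_one]
    exact mul_le_mul_of_nonneg_left (Real.rpow_le_rpow_of_exponent_le ht (by linarith))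
      zero_le_two
  have hexp : ∀ {f : ℝ → ℂ} {ν : Measure ℝ}, Integrable f ν →
      Integrable (fun x : ℝ => Complex.exp (I * τ * x) * f x) ν := fun hf =>
    hf.bdd_mul hexpc.aestronglyMeasurable (Filter.Eventually.of_forall fun x => (hnorm x).le)
  have hexp' : ∀ {f : ℝ → ℂ} {ν : Measure ℝ}, Integrable f ν →
      Integrable (fun x : ℝ => Complex.exp (I * τ * x) / (I * τ) * f x) ν := fun hf =>
    hf.bdd_mul (c := 2 / t) (by fun_prop) (Filter.Eventually.of_forall fun x => (hnorm' x).le)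
  have hqδ : IntegrableOn q (Ioi t⁻¹) := h.integrableOn.mono_set (Ioi_subset_Ioi hδ.le)
  have k1 := hexp (h.integrableOn.mono_set (Ioc_subset_Ioi_self : Ioc 0 t⁻¹ ⊆ Ioi 0))
  have k2 := hexp' (h.integrableOn_deriv hδ)
  have k3 := hexp' hqδ
  have c1 := continuous_translateIntegral k1 (-s) hA.continuous fun y => (hL y).1
  have c2 := continuous_translateIntegral k2 (-s) hA.continuous fun y => (hL y).1
  have c3 := continuous_translateIntegral k3 (-s) hA.continuous_deriv fun y => (hL y).2
  have c4 : Continuous fun y => A (y + -s * t⁻¹) := hA.continuous.comp (by fun_prop)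
  set a := eLpNorm A 2 (volume : Measure ℝ) with ha
  set a' := eLpNorm A' 2 (volume : Measure ℝ) with ha'
  have b1 := eLpNorm_translateIntegral_le k1.aestronglyMeasurable (-s) hA.continuous
  have b2 := eLpNorm_translateIntegral_le k2.aestronglyMeasurable (-s) hA.continuous
  have b3 := eLpNorm_translateIntegral_le k3.aestronglyMeasurable (-s) hA.continuous_deriv
  have b4 : eLpNorm (fun y => A (y + -s * t⁻¹)) 2 (volume : Measure ℝ) = a :=
    eLpNorm_comp_measurePreserving hA.continuous.aestronglyMeasurable
      (measurePreserving_add_right volume (-s * t⁻¹))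
  have n1 : ∫⁻ x in Ioc 0 t⁻¹, ‖Complex.exp (I * τ * x) * q x‖ₑ ≤
      ENNReal.ofReal (C / (1 / 2 - μ) * R) := by
    refine le_trans (le_of_eq ?_) ((h.lintegral_Ioc_le hδ).trans_eq (by rw [hδ1]))
    refine lintegral_congr fun x => ?_
    rw [enorm_mul, ← ofReal_norm, hnorm, ENNReal.ofReal_one, one_mul]
  have n2 : ∫⁻ x in Ioi t⁻¹, ‖Complex.exp (I * τ * x) / (I * τ) * q' x‖ₑ ≤
      ENNReal.ofReal (2 * (C / (1 / 2 + μ)) * R) := by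
    have e : ∀ x : ℝ, ‖Complex.exp (I * τ * x) / (I * τ) * q' x‖ₑ =
        ENNReal.ofReal (2 / t) * ‖q' x‖ₑ := fun x => by
      rw [enorm_mul, ← ofReal_norm (_ / _), hnorm']
    simp only [e]
    rw [lintegral_const_mul' _ _ ENNReal.ofReal_ne_top]
    refine (mul_le_mul_right (h.lintegral_deriv_Ioi_le hδ) _).trans_eq ?_
    rw [← ENNReal.ofReal_mul (by positivity)]
    congr 1
    linear_combination (C / (1 / 2 + μ)) * hδ2
  have n3 : ∫⁻ x in Ioi t⁻¹, ‖Complex.exp (I * τ * x) / (I * τ) * q x‖ₑ ≤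
      ENNReal.ofReal (2 * K0 * R) := by
    have e : ∀ x : ℝ, ‖Complex.exp (I * τ * x) / (I * τ) * q x‖ₑ =
        ENNReal.ofReal (2 / t) * ‖q x‖ₑ := fun x => by
      rw [enorm_mul, ← ofReal_norm (_ / _), hnorm']
    simp only [e]
    rw [lintegral_const_mul' _ _ ENNReal.ofReal_ne_top]
    have h1 : ∫⁻ x in Ioi t⁻¹, ‖q x‖ₑ ≤ ENNReal.ofReal K0 :=
      (lintegral_mono_set (Ioi_subset_Ioi hδ.le)).trans
        (lintegral_enorm_le_ofReal h.integrableOn.norm (Filter.Eventually.of_forall fun _ => le_rfl))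
    refine (mul_le_mul_right h1 _).trans ?_
    rw [← ENNReal.ofReal_mul (by positivity)]
    exact ENNReal.ofReal_le_ofReal (by nlinarith)
  have n4 : ‖q t⁻¹ * (Complex.exp (I * τ * (t⁻¹ : ℝ)) / (I * τ))‖ₑ ≤ ENNReal.ofReal (2 * C * R) := by
    rw [← ofReal_norm, norm_mul, hnorm']
    refine ENNReal.ofReal_le_ofReal ?_
    calc _ ≤ C * t⁻¹ ^ (-1 / 2 - μ) * (2 / t) := by
          gcongr
          exact h.norm_le_rpow hδ
      _ = _ := by linear_combination C * hδ2
  have hfun := funext (h.integral_exp_mul_eq hδ hτ s hA)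
  rw [hfun]
  have hs' : ‖(s : ℂ)‖ₑ = ENNReal.ofReal s := by
    rw [← ofReal_norm, Complex.norm_real, Real.norm_of_nonneg hs]
  calc _ ≤ ENNReal.ofReal (C / (1 / 2 - μ) * R) * a + ENNReal.ofReal (2 * C * R) * a
        + ENNReal.ofReal (2 * (C / (1 / 2 + μ)) * R) * a
        + ENNReal.ofReal s * (ENNReal.ofReal (2 * K0 * R) * a') := by
        refine (eLpNorm_add_le_of_continuous ((c1.sub (continuous_const.mul c4)).sub c2)
          (continuous_const.mul c3)).trans (add_le_add ?_ ?_)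
        · refine (eLpNorm_sub_le_of_continuous (c1.sub (continuous_const.mul c4)) c2).trans
            (add_le_add ?_ ?_)
          · refine (eLpNorm_sub_le_of_continuous c1 (continuous_const.mul c4)).trans
              (add_le_add ?_ ?_)
            · exact b1.trans (by gcongr)
            · refine (eLpNorm_const_mul _ _).trans_le ?_
              rw [b4]
              gcongr
          · exact b2.trans (by gcongr)
        · refine (eLpNorm_const_mul _ _).trans_le ?_
          rw [hs']
          gcongr
          exact b3.trans (by gcongr)
    _ ≤ ENNReal.ofReal ((C / (1 / 2 - μ) + 2 * C + 2 * (C / (1 / 2 + μ)) + 2 * K0) * R) * a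
        + ENNReal.ofReal s * (ENNReal.ofReal
          ((C / (1 / 2 - μ) + 2 * C + 2 * (C / (1 / 2 + μ)) + 2 * K0) * R) * a') := by
        rw [← add_mul, ← add_mul, ← ENNReal.ofReal_add (by positivity) (by positivity),
          ← ENNReal.ofReal_add (by positivity) (by positivity)]
        have p1 : 0 ≤ C / (1 / 2 - μ) * R := by positivity
        have p2 : 0 ≤ 2 * C * R := by positivity
        have p3 : 0 ≤ 2 * (C / (1 / 2 + μ)) * R := by positivity
        have p4 : 0 ≤ 2 * K0 * R := by positivity
        refine add_le_add (mul_le_mul_left (ENNReal.ofReal_le_ofReal ?_) _)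
          (mul_le_mul_right (mul_le_mul_left (ENNReal.ofReal_le_ofReal ?_) _) _) <;>
        simp only [add_mul] <;> linarith
    _ = _ := by ring

end

/-- The superposition of translates of `F` and `H` with weights `w` and `x w`, at scale `s`. -/
def scaledSource (w : ℝ → ℂ) (s : ℝ) (F H : ℝ → ℂ) (y : ℝ) : ℂ :=
  s * (translateIntegral (volume.restrict (Ioi 0)) w s F y
    + s * translateIntegral (volume.restrict (Ioi 0)) (fun x => x * w x) s H y)

theorem integral_comp_mul_eq_scaledSource {w : ℝ → ℂ} (hw : IntegrableOn w (Ioi 0))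
    (hw1 : IntegrableOn (fun x : ℝ => x * w x) (Ioi 0)) {F F' H H' : ℝ → ℂ}
    (hF : BoundedC1 F F') (hH : BoundedC1 H H') {b : ℝ} (hb : 0 < b) (z : ℝ) :
    ∫ ξ in Ioi (0 : ℝ), w (b * ξ) * (F (z + ξ) + ξ * H (z + ξ)) = scaledSource w b⁻¹ F H z := by
  obtain ⟨K, hK⟩ := hF.bounded
  obtain ⟨L, hL⟩ := hH.bounded
  have i0 := integrable_mul_translate hw b⁻¹ hF.continuous (fun y => (hK y).1) z
  have i1 := (integrable_mul_translate hw1 b⁻¹ hH.continuous (fun y => (hL y).1) z).const_mul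
    ((b⁻¹ : ℝ) : ℂ)
  have h := integral_comp_mul_left_Ioi
    (fun x : ℝ => w x * F (z + b⁻¹ * x) + ((b⁻¹ : ℝ) : ℂ) * (x * w x * H (z + b⁻¹ * x))) 0 hb
  rw [mul_zero, integral_add i0 i1, integral_const_mul] at h
  rw [scaledSource, translateIntegral, translateIntegral, ← Complex.real_smul, ← h]
  refine integral_congr_ae (Filter.Eventually.of_forall fun ξ => ?_)
  have e : b⁻¹ * (b * ξ) = ξ := by field_simp
  have e' : ((b⁻¹ : ℝ) : ℂ) * ((b * ξ : ℝ) : ℂ) = ξ := by rw [← Complex.ofReal_mul, e]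
  simp only [e]
  linear_combination -(w (b * ξ) * H (z + ξ)) * e'

theorem BoundedC1.scaledSource {w : ℝ → ℂ} (hw : IntegrableOn w (Ioi 0))
    (hw1 : IntegrableOn (fun x : ℝ => x * w x) (Ioi 0)) {F F' H H' : ℝ → ℂ}
    (hF : BoundedC1 F F') (hH : BoundedC1 H H') (s : ℝ) :
    BoundedC1 (scaledSource w s F H) (scaledSource w s F' H') :=
  ((BoundedC1.translateIntegral hw s hF).add
    ((BoundedC1.translateIntegral hw1 s hH).const_mul s)).const_mul s

theorem eLpNorm_scaledSource_le {w : ℝ → ℂ} (hw : IntegrableOn w (Ioi 0))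
    (hw1 : IntegrableOn (fun x : ℝ => x * w x) (Ioi 0)) {F H : ℝ → ℂ} (hF : Continuous F)
    (hH : Continuous H) {K L : ℝ} (hK : ∀ y, ‖F y‖ ≤ K) (hL : ∀ y, ‖H y‖ ≤ L) {s : ℝ} (hs : 0 ≤ s)
    (hs1 : s ≤ 1) :
    eLpNorm (scaledSource w s F H) 2 volume ≤ ENNReal.ofReal s *
      (ENNReal.ofReal ((∫ x in Ioi 0, ‖w x‖) + ∫ x : ℝ in Ioi 0, ‖x * w x‖) *
        (eLpNorm F 2 volume + eLpNorm H 2 volume)) := by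
  have hs' : ‖(s : ℂ)‖ₑ = ENNReal.ofReal s := by
    rw [← ofReal_norm, Complex.norm_real, Real.norm_of_nonneg hs]
  have n0 := lintegral_enorm_le_ofReal hw.norm (Filter.Eventually.of_forall fun _ => le_rfl)
  have n1 := lintegral_enorm_le_ofReal hw1.norm (Filter.Eventually.of_forall fun _ => le_rfl)
  have p0 : 0 ≤ ∫ x in Ioi 0, ‖w x‖ := integral_nonneg fun x => norm_nonneg _
  have p1 : 0 ≤ ∫ x : ℝ in Ioi 0, ‖x * w x‖ := integral_nonneg fun x => norm_nonneg _
  refine (eLpNorm_const_mul _ _).trans_le ?_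
  rw [hs']
  gcongr
  refine (eLpNorm_add_le_of_continuous (continuous_translateIntegral hw s hF hK)
    (continuous_const.mul (continuous_translateIntegral hw1 s hH hL))).trans ?_
  rw [mul_add]
  refine add_le_add ?_ ?_
  · refine (eLpNorm_translateIntegral_le hw.aestronglyMeasurable s hF).trans
      (mul_le_mul_left (n0.trans (ENNReal.ofReal_le_ofReal ?_)) _)
    linarith
  · refine (eLpNorm_const_mul _ _).trans_le ?_
    rw [hs']
    refine (mul_le_of_le_one_left' (ENNReal.ofReal_le_one.2 hs1)).trans ?_
    refine (eLpNorm_translateIntegral_le hw1.aestronglyMeasurable s hH).trans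
      (mul_le_mul_left (n1.trans (ENNReal.ofReal_le_ofReal ?_)) _)
    linarith

/-- The oscillatory double integral with weight `w`, frequency `τ` and scale `b`. -/
def oscDouble (w : ℝ → ℂ) (b τ : ℝ) (F H : ℝ → ℂ) (y : ℝ) : ℂ :=
  ∫ η in Ioi (0 : ℝ), Complex.exp (I * τ * (b * η)) * (w (b * η) / η) *
    ∫ ξ in Ioi (0 : ℝ), w (b * ξ) * (F (y - η + ξ) + ξ * H (y - η + ξ))

theorem oscDouble_eq {w : ℝ → ℂ} (hw : IntegrableOn w (Ioi 0))
    (hw1 : IntegrableOn (fun x : ℝ => x * w x) (Ioi 0)) {F F' H H' : ℝ → ℂ}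
    (hF : BoundedC1 F F') (hH : BoundedC1 H H') {b : ℝ} (hb : 0 < b) (τ y : ℝ) :
    oscDouble w b τ F H y = translateIntegral (volume.restrict (Ioi 0))
      (fun x : ℝ => Complex.exp (I * τ * x) * (w x / x)) (-b⁻¹) (scaledSource w b⁻¹ F H) y := by
  have h := integral_comp_mul_left_Ioi (fun x : ℝ => Complex.exp (I * τ * x) * (w x / x)
    * scaledSource w b⁻¹ F H (y + -b⁻¹ * x)) 0 hb
  have hb' : (b : ℂ) ≠ 0 := by exact_mod_cast hb.ne'
  rw [mul_zero, eq_inv_smul_iff₀ hb.ne', Complex.real_smul, ← integral_const_mul] at h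
  rw [oscDouble, translateIntegral, ← h]
  refine integral_congr_ae (Filter.Eventually.of_forall fun η => ?_)
  have e : y + -b⁻¹ * (b * η) = y - η := by field_simp; ring
  simp only [e, integral_comp_mul_eq_scaledSource hw hw1 hF hH hb]
  push_cast
  field_simp

theorem OscWeight.exists_eLpNorm_oscDouble_le {μ C : ℝ} {w q' : ℝ → ℂ}
    (h : OscWeight μ C (fun x => w x / x) q') (hw : IntegrableOn w (Ioi 0))
    (hw1 : IntegrableOn (fun x : ℝ => x * w x) (Ioi 0)) : ∃ K : ℝ, 0 ≤ K ∧
    ∀ t τ : ℝ, 1 ≤ t → |τ| = t / 2 → ∀ b : ℝ, 1 ≤ b → ∀ F F' H H' : ℝ → ℂ, BoundedC1 F F' →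
      BoundedC1 H H' → eLpNorm (oscDouble w b τ F H) 2 volume ≤
        ENNReal.ofReal (K * t ^ (-1 / 2 + μ)) * (ENNReal.ofReal b⁻¹ *
          (eLpNorm F 2 volume + eLpNorm H 2 volume
            + (eLpNorm F' 2 volume + eLpNorm H' 2 volume))) := by
  obtain ⟨K, hK, hb⟩ := h.exists_eLpNorm_le
  set N := (∫ x in Ioi 0, ‖w x‖) + ∫ x : ℝ in Ioi 0, ‖x * w x‖ with hN
  have hN0 : 0 ≤ N := add_nonneg (integral_nonneg fun x => norm_nonneg _)
    (integral_nonneg fun x => norm_nonneg _)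
  refine ⟨K * N, by positivity, fun t τ ht hτ b hb1 F F' H H' hF hH => ?_⟩
  have hb0 : 0 < b := by linarith
  have hs1 : b⁻¹ ≤ 1 := inv_le_one_of_one_le₀ hb1
  have hs0 : 0 ≤ b⁻¹ := by positivity
  have e : oscDouble w b τ F H = _ := funext (oscDouble_eq hw hw1 hF hH hb0 τ)
  obtain ⟨L, hL⟩ := hF.bounded
  obtain ⟨M, hM⟩ := hH.bounded
  have n1 := eLpNorm_scaledSource_le hw hw1 hF.continuous hH.continuous (fun y => (hL y).1)
    (fun y => (hM y).1) hs0 hs1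
  have n2 := eLpNorm_scaledSource_le hw hw1 hF.continuous_deriv hH.continuous_deriv
    (fun y => (hL y).2) (fun y => (hM y).2) hs0 hs1
  rw [← hN] at n1 n2
  rw [e]
  refine (hb t τ ht hτ b⁻¹ hs0 _ _ (BoundedC1.scaledSource hw hw1 hF hH b⁻¹)).trans ?_
  calc _ ≤ ENNReal.ofReal (K * t ^ (-1 / 2 + μ)) *
        (ENNReal.ofReal b⁻¹ * (ENNReal.ofReal N * (eLpNorm F 2 volume + eLpNorm H 2 volume))
        + 1 * (ENNReal.ofReal b⁻¹ *
          (ENNReal.ofReal N * (eLpNorm F' 2 volume + eLpNorm H' 2 volume)))) := by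
        gcongr
        exact ENNReal.ofReal_le_one.2 hs1
    _ = _ := by
        rw [show K * N * t ^ (-1 / 2 + μ) = (K * t ^ (-1 / 2 + μ)) * N by ring,
          ENNReal.ofReal_mul' (q := N) hN0]
        ring

theorem OscWeight.continuous_oscDouble {μ C : ℝ} {w q' : ℝ → ℂ}
    (h : OscWeight μ C (fun x => w x / x) q') (hw : IntegrableOn w (Ioi 0))
    (hw1 : IntegrableOn (fun x : ℝ => x * w x) (Ioi 0)) {F F' H H' : ℝ → ℂ} (hF : BoundedC1 F F')
    (hH : BoundedC1 H H') {b : ℝ} (hb : 0 < b) (τ : ℝ) : Continuous (oscDouble w b τ F H) := by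
  have e : oscDouble w b τ F H = _ := funext (oscDouble_eq hw hw1 hF hH hb τ)
  have hs := BoundedC1.scaledSource hw hw1 hF hH b⁻¹
  obtain ⟨K, hK⟩ := hs.bounded
  have hexpc : Continuous fun x : ℝ => Complex.exp (I * τ * x) := by fun_prop
  rw [e]
  refine continuous_translateIntegral (h.integrableOn.bdd_mul (c := 1) hexpc.aestronglyMeasurable
    (Filter.Eventually.of_forall fun x => ?_)) _ hs.continuous fun y => (hK y).1
  rw [show I * (τ : ℂ) * x = ((τ * x : ℝ) : ℂ) * I by push_cast; ring]
  exact (Complex.norm_exp_ofReal_mul_I _).le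

/-- The one-dimensional Helmholtz operator `∂² − m²`. -/
def helmholtz (m : ℕ) (f : ℝ → ℂ) (u : ℝ) : ℂ := deriv (deriv f) u - (m : ℂ) ^ 2 * f u

theorem BoundedC1.helmholtz (m : ℕ) {f : ℝ → ℂ} (hf : ContDiff ℝ (⊤ : ℕ∞) f)
    (hs : HasCompactSupport f) : BoundedC1 (helmholtz m f) (helmholtz m (deriv f)) := by
  have h1 := (contDiff_infty_iff_deriv.1 hf).2
  have h2 := (contDiff_infty_iff_deriv.1 h1).2
  have b0 := BoundedC1.of_compactSupport (hf.of_le (by exact_mod_cast le_top)) hs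
  have b2 := BoundedC1.of_compactSupport (h2.of_le (by exact_mod_cast le_top)) hs.deriv.deriv
  have h := b2.add (b0.const_mul (-(m : ℂ) ^ 2))
  simp only [neg_mul, ← sub_eq_add_neg] at h
  exact h

theorem eLpNorm_helmholtz_le {m : ℕ} (hm : 1 ≤ m) {f : ℝ → ℂ} (hf : ContDiff ℝ (⊤ : ℕ∞) f) :
    eLpNorm (helmholtz m f) 2 (volume : Measure ℝ) ≤ ENNReal.ofReal ((m : ℝ) ^ 2) *
      (eLpNorm (deriv (deriv f)) 2 volume + eLpNorm f 2 volume) := by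
  have h1 := (contDiff_infty_iff_deriv.1 hf).2
  have h2 := (contDiff_infty_iff_deriv.1 h1).2
  refine (eLpNorm_sub_le_of_continuous h2.continuous
    (continuous_const.mul hf.continuous)).trans ?_
  rw [mul_add]
  refine add_le_add ?_ ?_
  · refine le_mul_of_one_le_left' (ENNReal.one_le_ofReal.2 (one_le_pow₀ (by exact_mod_cast hm)))
  · refine (eLpNorm_const_mul _ _).trans_le (le_of_eq ?_)
    rw [← ofReal_norm, norm_pow, Complex.norm_natCast]

theorem eLpNorm_comp_neg {f : ℝ → ℂ} (hf : Continuous f) :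
    eLpNorm (fun y => f (-y)) 2 (volume : Measure ℝ) = eLpNorm f 2 volume :=
  eLpNorm_comp_measurePreserving hf.aestronglyMeasurable (Measure.measurePreserving_neg volume)

/-- The density mode as a superposition of two oscillatory double integrals. -/
theorem rhoM_eq (β : ℝ) {m : ℕ} (ρ₀ ω₀ : ℝ → ℂ) (t y : ℝ) :
    rhoM β m ρ₀ ω₀ t y =
      Complex.exp (-(I * m * y * t)) * (Complex.cos (gam β * (π : ℂ)) / (2 * m * (π : ℂ)) *
        (oscDouble (fun x => whittW (gam β) x) (2 * m) (t / 2) (helmholtz m ρ₀)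
            (fun u => -(1 / (β : ℂ) ^ 2) * helmholtz m ω₀ u) y
          + oscDouble (fun x => whittW (gam β) x) (2 * m) (-(t / 2))
            (fun u => helmholtz m ρ₀ (-u))
            (fun u => -(-(1 / (β : ℂ) ^ 2) * helmholtz m ω₀ (-u))) (-y))) := by
  have e1 : ∀ η : ℝ, Complex.exp (I * (t / 2 : ℝ) * ((2 * m : ℝ) * η))
      = Complex.exp (I * m * η * t) := fun η => by
    congr 1; push_cast; ring
  have e2 : ∀ η : ℝ, Complex.exp (I * (-(t / 2) : ℝ) * ((2 * m : ℝ) * η))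
      = Complex.exp (-(I * m * η * t)) := fun η => by
    congr 1; push_cast; ring
  have e3 : ∀ η : ℝ, ((2 * m * η : ℝ) : ℂ) = 2 * m * η := fun η => by push_cast; ring
  have e4 : ∀ η ξ : ℝ, helmholtz m ρ₀ (y - η + ξ)
      + ξ * (-(1 / (β : ℂ) ^ 2) * helmholtz m ω₀ (y - η + ξ)) = Gm β m ρ₀ ω₀ η ξ y := by
    intro η ξ
    rw [Gm, helmholtz, helmholtz, show y - η + ξ = ξ + y - η by ring]
    ring
  have e5 : ∀ η ξ : ℝ, helmholtz m ρ₀ (-(-y - η + ξ))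
      + ξ * (-(-(1 / (β : ℂ) ^ 2) * helmholtz m ω₀ (-(-y - η + ξ))))
      = Gm β m ρ₀ ω₀ (-η) (-ξ) y := by
    intro η ξ
    rw [Gm, helmholtz, helmholtz, show -(-y - η + ξ) = -ξ + y - -η by ring]
    push_cast
    ring
  rw [rhoM, oscDouble, oscDouble]
  simp only [e1, e2, e3, e4, e5]
  ring

theorem exists_oscWeight_whittW {β : ℝ} (hβ : 0 < β) : ∃ (C : ℝ) (q' : ℝ → ℂ),
    OscWeight (gam β).re C (fun x => whittW (gam β) x / x) q' ∧
    IntegrableOn (fun x : ℝ => whittW (gam β) x) (Ioi 0) ∧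
    IntegrableOn (fun x : ℝ => x * whittW (gam β) x) (Ioi 0) := by
  obtain ⟨W', C, hC, hd, hc, hW, hW'⟩ := exists_whittW_bound hβ
  have hμ0 := gam_re_nonneg β
  have hμ1 := gam_re_lt hβ
  set μ := (gam β).re
  have hWc : ContinuousOn (fun x : ℝ => whittW (gam β) x) (Ioi 0) :=
    fun x hx => (hd x hx).continuousAt.continuousWithinAt
  have hx0 : ∀ x : ℝ, 0 < x → (x : ℂ) ≠ 0 := fun x hx => by exact_mod_cast hx.ne'
  have hxc : ContinuousOn (fun x : ℝ => (x : ℂ)) (Ioi 0) := Complex.continuous_ofReal.continuousOn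
  refine ⟨2 * C, fun x => W' x / x - whittW (gam β) x / x ^ 2,
    ⟨hμ0, hμ1, by positivity, fun x hx => ?_, ?_, fun x hx => ?_, fun x hx => ?_⟩, ?_, ?_⟩
  · have h1 : HasDerivAt (fun x : ℝ => (x : ℂ)) 1 x := (hasDerivAt_id x).ofReal_comp
    refine ((hd x hx).div h1 (hx0 x hx)).congr_deriv ?_
    have := hx0 x hx
    field_simp
  · exact (hc.div hxc fun x hx => hx0 x hx).sub
      (hWc.div (hxc.pow 2) fun x hx => pow_ne_zero 2 (hx0 x hx))
  · rw [norm_div, Complex.norm_real, Real.norm_of_nonneg hx.le, div_le_iff₀ hx]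
    refine (hW x hx).trans ?_
    rw [show 1 / 2 - μ = (-1 / 2 - μ) + 1 by ring, Real.rpow_add_one hx.ne']
    have := Real.rpow_nonneg hx.le (-1 / 2 - μ)
    have h2 : 0 ≤ C * (x ^ (-1 / 2 - μ) * x * Real.exp (-x / 8)) := by positivity
    linarith
  · have he : Real.exp (-x / 8) ≤ 1 := Real.exp_le_one_iff.2 (by linarith)
    have p := Real.rpow_pos_of_pos hx (-3 / 2 - μ)
    have b1 : ‖W' x / x‖ ≤ C * x ^ (-3 / 2 - μ) := by
      rw [norm_div, Complex.norm_real, Real.norm_of_nonneg hx.le, div_le_iff₀ hx]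
      refine (hW' x hx).trans ?_
      rw [show -1 / 2 - μ = (-3 / 2 - μ) + 1 by ring, Real.rpow_add_one hx.ne']
      calc _ = C * x ^ (-3 / 2 - μ) * x * Real.exp (-x / 8) := by ring
        _ ≤ _ := mul_le_of_le_one_right (by positivity) he
    have b2 : ‖whittW (gam β) x / x ^ 2‖ ≤ C * x ^ (-3 / 2 - μ) := by
      rw [norm_div, norm_pow, Complex.norm_real, Real.norm_of_nonneg hx.le,
        div_le_iff₀ (by positivity)]
      refine (hW x hx).trans ?_
      rw [show 1 / 2 - μ = (-3 / 2 - μ) + 1 + 1 by ring, Real.rpow_add_one hx.ne',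
        Real.rpow_add_one hx.ne']
      calc _ = C * x ^ (-3 / 2 - μ) * x ^ 2 * Real.exp (-x / 8) := by ring
        _ ≤ _ := mul_le_of_le_one_right (by positivity) he
    calc _ ≤ ‖W' x / x‖ + ‖whittW (gam β) x / x ^ 2‖ := norm_sub_le _ _
      _ ≤ _ := by linarith
  · exact integrableOn_of_norm_le_rpow_mul_exp hWc (by linarith) hW
  · refine integrableOn_of_norm_le_rpow_mul_exp (s := 3 / 2 - μ) (B := C) (hxc.mul hWc)
      (by linarith) fun x hx => ?_
    rw [norm_mul, Complex.norm_real, Real.norm_of_nonneg hx.le]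
    calc _ ≤ x * (C * (x ^ (1 / 2 - μ) * Real.exp (-x / 8))) := by
          gcongr
          exact hW x hx
      _ = _ := by
        rw [show 3 / 2 - μ = (1 / 2 - μ) + 1 by ring, Real.rpow_add_one hx.ne']
        ring

theorem Qsum_four (ρ₀ ω₀ : ℝ → ℂ) : Qsum 4 ρ₀ ω₀ =
    (eLpNorm (deriv (deriv ρ₀)) 2 volume + eLpNorm ρ₀ 2 volume)
      + (eLpNorm (deriv (deriv ω₀)) 2 volume + eLpNorm ω₀ 2 volume)
      + ((eLpNorm (deriv (deriv (deriv ρ₀))) 2 volume + eLpNorm (deriv ρ₀) 2 volume)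
      + (eLpNorm (deriv (deriv (deriv ω₀))) 2 volume + eLpNorm (deriv ω₀) 2 volume)) := by
  simp only [Qsum, Finset.sum_range_succ, Finset.sum_range_zero, iteratedDeriv_succ,
    iteratedDeriv_zero]
  ring

theorem eLpNorm_helmholtz_add_le {β : ℝ} {m : ℕ} (hm : 1 ≤ m) {ρ₀ ω₀ : ℝ → ℂ}
    (hρ : ContDiff ℝ (⊤ : ℕ∞) ρ₀) (hω : ContDiff ℝ (⊤ : ℕ∞) ω₀) :
    eLpNorm (helmholtz m ρ₀) 2 volume
        + eLpNorm (fun u => -(1 / (β : ℂ) ^ 2) * helmholtz m ω₀ u) 2 volume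
      + (eLpNorm (helmholtz m (deriv ρ₀)) 2 volume
        + eLpNorm (fun u => -(1 / (β : ℂ) ^ 2) * helmholtz m (deriv ω₀) u) 2 volume)
      ≤ ENNReal.ofReal ((1 + 1 / β ^ 2) * (m : ℝ) ^ 2) * Qsum 4 ρ₀ ω₀ := by
  have hn : ‖-(1 / (β : ℂ) ^ 2)‖ₑ = ENNReal.ofReal (1 / β ^ 2) := by
    rw [enorm_neg, ← ofReal_norm, norm_div, norm_one, norm_pow, Complex.norm_real, Real.norm_eq_abs,
      sq_abs]
  have hρ' := (contDiff_infty_iff_deriv.1 hρ).2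
  have hω' := (contDiff_infty_iff_deriv.1 hω).2
  have hB : 0 ≤ 1 / β ^ 2 := by positivity
  have c1 : (1 : ℝ≥0∞) ≤ ENNReal.ofReal (1 + 1 / β ^ 2) :=
    ENNReal.one_le_ofReal.2 (by linarith)
  have c2 : ENNReal.ofReal (1 / β ^ 2) ≤ ENNReal.ofReal (1 + 1 / β ^ 2) :=
    ENNReal.ofReal_le_ofReal (by linarith)
  have l1 := (eLpNorm_helmholtz_le hm hρ).trans (le_mul_of_one_le_left' c1)
  have l2 := mul_le_mul' c2 (eLpNorm_helmholtz_le hm hω)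
  have l3 := (eLpNorm_helmholtz_le hm hρ').trans (le_mul_of_one_le_left' c1)
  have l4 := mul_le_mul' c2 (eLpNorm_helmholtz_le hm hω')
  rw [eLpNorm_const_mul, eLpNorm_const_mul, hn, Qsum_four, ENNReal.ofReal_mul (by positivity)]
  refine (add_le_add (add_le_add l1 l2) (add_le_add l3 l4)).trans_eq ?_
  ring

/-- Decay of a single density mode, uniformly in the frequency. -/
theorem exists_eLpNorm_rhoM_le {β : ℝ} (hβ : 0 < β) : ∃ C : ℝ, 0 < C ∧
    ∀ m : ℕ, 1 ≤ m → ∀ ρ₀ ω₀ : ℝ → ℂ, ContDiff ℝ (⊤ : ℕ∞) ρ₀ → HasCompactSupport ρ₀ →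
      ContDiff ℝ (⊤ : ℕ∞) ω₀ → HasCompactSupport ω₀ → ∀ t : ℝ, 1 ≤ t →
        eLpNorm (fun y => rhoM β m ρ₀ ω₀ t y) 2 (volume : Measure ℝ) ≤
          ENNReal.ofReal (C * t ^ (-(1 : ℝ) / 2 + (gam β).re)) * Qsum 4 ρ₀ ω₀ := by
  obtain ⟨C, q', hq, hw, hw1⟩ := exists_oscWeight_whittW hβ
  obtain ⟨K, hK, hb⟩ := hq.exists_eLpNorm_oscDouble_le hw hw1
  set c := ‖Complex.cos (gam β * (π : ℂ))‖ with hc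
  have hc0 : 0 ≤ c := norm_nonneg _
  have hπ := Real.pi_pos
  refine ⟨c * K * (1 + 1 / β ^ 2) / (2 * π) + 1, by positivity,
    fun m hm ρ₀ ω₀ hρ hρs hω hωs t ht => ?_⟩
  have hm0 : (0 : ℝ) < m := by exact_mod_cast hm
  have hm1 : (1 : ℝ) ≤ 2 * m := by
    have : (1 : ℝ) ≤ m := by exact_mod_cast hm
    linarith
  have ht0 : 0 < t := by linarith
  have bρ := BoundedC1.helmholtz m hρ hρs
  have bω := (BoundedC1.helmholtz m hω hωs).const_mul (-(1 / (β : ℂ) ^ 2))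
  have bω' := bω.comp_neg.const_mul (-1)
  simp only [neg_one_mul] at bω'
  have n1 := hb t (t / 2) ht (abs_of_pos (by positivity)) (2 * m) hm1 _ _ _ _ bρ bω
  have n2 := hb t (-(t / 2)) ht (by rw [abs_neg]; exact abs_of_pos (by positivity)) (2 * m) hm1
    _ _ _ _ bρ.comp_neg bω'
  have hneg : ∀ f : ℝ → ℂ, eLpNorm (fun y => -f y) 2 (volume : Measure ℝ) = eLpNorm f 2 volume :=
    fun f => eLpNorm_neg f 2 volume
  simp only [hneg] at n2
  rw [eLpNorm_comp_neg bρ.continuous, eLpNorm_comp_neg bω.continuous,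
    eLpNorm_comp_neg bρ.continuous_deriv, eLpNorm_comp_neg bω.continuous_deriv] at n2
  have n3 := eLpNorm_helmholtz_add_le (β := β) hm hρ hω
  have d1 : Continuous (oscDouble (fun x => whittW (gam β) x) (2 * m) (t / 2) (helmholtz m ρ₀)
      (fun u => -(1 / (β : ℂ) ^ 2) * helmholtz m ω₀ u)) :=
    hq.continuous_oscDouble hw hw1 bρ bω (by positivity) _
  have d2 : Continuous (oscDouble (fun x => whittW (gam β) x) (2 * m) (-(t / 2))
      (fun u => helmholtz m ρ₀ (-u))
      (fun u => -(-(1 / (β : ℂ) ^ 2) * helmholtz m ω₀ (-u)))) :=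
    hq.continuous_oscDouble hw hw1 bρ.comp_neg bω' (by positivity) _
  have hphase : ∀ y : ℝ, ‖Complex.exp (-(I * m * y * t))‖ = 1 := fun y => by
    rw [show -(I * (m : ℂ) * y * t) = ((-(m * y * t) : ℝ) : ℂ) * I by push_cast; ring]
    exact Complex.norm_exp_ofReal_mul_I _
  simp only [rhoM_eq]
  set N := eLpNorm (helmholtz m ρ₀) 2 volume
        + eLpNorm (fun u => -(1 / (β : ℂ) ^ 2) * helmholtz m ω₀ u) 2 volume
      + (eLpNorm (helmholtz m (deriv ρ₀)) 2 volume
        + eLpNorm (fun u => -(1 / (β : ℂ) ^ 2) * helmholtz m (deriv ω₀) u) 2 volume) with hN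
  set R := t ^ (-(1 : ℝ) / 2 + (gam β).re) with hR
  have hR0 : 0 ≤ R := Real.rpow_nonneg ht0.le _
  rw [← eLpNorm_comp_neg d2] at n2
  have hcongr : ∀ g : ℝ → ℂ, eLpNorm (fun y : ℝ => Complex.exp (-(I * m * y * t)) * g y) 2
      (volume : Measure ℝ) = eLpNorm g 2 volume := fun g =>
    eLpNorm_congr_norm_ae (Filter.Eventually.of_forall fun y => by
      rw [norm_mul, hphase, one_mul])
  refine ((hcongr _).trans (eLpNorm_const_mul _ _)).trans_le ?_
  have hcn : ‖Complex.cos (gam β * (π : ℂ)) / (2 * m * (π : ℂ))‖ₑ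
      = ENNReal.ofReal (c / (2 * m * π)) := by
    rw [← ofReal_norm, norm_div, norm_mul, norm_mul, Complex.norm_real, Complex.norm_natCast,
      Complex.norm_ofNat, Real.norm_of_nonneg hπ.le]
  rw [hcn]
  calc _ ≤ ENNReal.ofReal (c / (2 * m * π)) * (ENNReal.ofReal (K * R) *
          (ENNReal.ofReal (2 * m : ℝ)⁻¹ * N)
          + ENNReal.ofReal (K * R) * (ENNReal.ofReal (2 * m : ℝ)⁻¹ * N)) := by
        gcongr
        exact (eLpNorm_add_le_of_continuous d1 (d2.comp continuous_neg)).trans (add_le_add n1 n2)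
    _ = ENNReal.ofReal (c / (2 * m * π)) * ENNReal.ofReal (K * R) *
          ENNReal.ofReal (2 * m : ℝ)⁻¹ * ENNReal.ofReal 2 * N := by
        rw [ENNReal.ofReal_ofNat]; ring
    _ ≤ ENNReal.ofReal (c / (2 * m * π)) * ENNReal.ofReal (K * R) *
          ENNReal.ofReal (2 * m : ℝ)⁻¹ * ENNReal.ofReal 2 *
          (ENNReal.ofReal ((1 + 1 / β ^ 2) * (m : ℝ) ^ 2) * Qsum 4 ρ₀ ω₀) := by gcongr
    _ = ENNReal.ofReal (c * K * (1 + 1 / β ^ 2) / (2 * π) * R) * Qsum 4 ρ₀ ω₀ := by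
        rw [← mul_assoc, ← ENNReal.ofReal_mul (by positivity), ← ENNReal.ofReal_mul (by positivity),
          ← ENNReal.ofReal_mul (by positivity), ← ENNReal.ofReal_mul (by positivity)]
        congr 2
        field_simp
    _ ≤ _ := by
        gcongr
        linarith

/-- Fourier-side form of estimate (1.14) of Theorem 1.2, case `β² ≠ 1/4`:
the density perturbation decays in `L²(𝕋×ℝ)` at rate `t^{−1/2+μ}`:
`(∑_{m≥1} ‖ρ_m(t)‖²_{L²})^{1/2} ≤ C t^{−1/2+μ} (∑_{m≥1} Q_{1,m}²)^{1/2}`. -/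
theorem rho_decay_summed (β : ℝ) (hβ : 0 < β) (hβ4 : β ^ 2 ≠ 1 / 4) :
    ∃ C : ℝ, 0 < C ∧
      ∀ (ρ₀ ω₀ : ℕ → ℝ → ℂ),
        (∀ m : ℕ, 1 ≤ m → ContDiff ℝ (⊤ : ℕ∞) (ρ₀ m) ∧ HasCompactSupport (ρ₀ m)
          ∧ ContDiff ℝ (⊤ : ℕ∞) (ω₀ m) ∧ HasCompactSupport (ω₀ m)) →
      ∀ t : ℝ, 1 ≤ t →
        (∑' m : ℕ,
            (eLpNorm (fun y => rhoM β (m + 1) (ρ₀ (m + 1)) (ω₀ (m + 1)) t y)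
              2 (volume : Measure ℝ)) ^ 2) ^ ((1 : ℝ) / 2) ≤
          ENNReal.ofReal (C * t ^ (-(1 : ℝ) / 2 + (gam β).re)) *
            (∑' m : ℕ, (Qsum 4 (ρ₀ (m + 1)) (ω₀ (m + 1))) ^ 2) ^ ((1 : ℝ) / 2) := by
  obtain ⟨C, hC, h⟩ := exists_eLpNorm_rhoM_le hβ
  refine ⟨C, hC, fun ρ₀ ω₀ hs t ht => ?_⟩
  set K := ENNReal.ofReal (C * t ^ (-(1 : ℝ) / 2 + (gam β).re))
  have hsq : (K ^ 2) ^ ((1 : ℝ) / 2) = K := by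
    rw [← ENNReal.rpow_natCast, ← ENNReal.rpow_mul]
    norm_num
  conv_rhs => rw [← hsq]
  rw [← ENNReal.mul_rpow_of_nonneg _ _ (by norm_num), ← ENNReal.tsum_mul_left]
  refine ENNReal.rpow_le_rpow (ENNReal.tsum_le_tsum fun m => ?_) (by norm_num)
  rw [← mul_pow]
  obtain ⟨h1, h2, h3, h4⟩ := hs (m + 1) (Nat.le_add_left 1 m)
  exact pow_le_pow_left' (h (m + 1) (Nat.le_add_left 1 m) _ _ h1 h2 h3 h4 t ht) 2
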